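/- Let G be a connected affine algebraic group over an algebraically closed field k and F : G → G an isogeny such that the fixed-point group G^F = {g ∈ G : F(g) = g} is finite. Then the Lang map L : G → G, g ↦ g⁻¹·F(g), is surjective. -/

import Mathlib

open MvPolynomial Matrix

noncomputable section

/-- Coordinates for `GL n` viewed as a closed subvariety of affine `2n²`-space
via `g ↦ (g, g⁻¹)`. -/
abbrev Coord (n : ℕ) := (Fin n × Fin n) ⊕ (Fin n × Fin n)

def coords {k : Type} [Field k] {n : ℕ} (g : GL (Fin n) k) : Coord n → k :=
  Sum.elim (fun p => (g : Matrix (Fin n) (Fin n) k) p.1 p.2)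
    (fun p => ((g⁻¹ : GL (Fin n) k) : Matrix (Fin n) (Fin n) k) p.1 p.2)

/-- Zariski-closed subsets of `GL n`. -/
def IsZClosed {k : Type} [Field k] {n : ℕ} (S : Set (GL (Fin n) k)) : Prop :=
  ∃ I : Set (MvPolynomial (Coord n) k),
    S = {g | ∀ P ∈ I, MvPolynomial.eval (coords g) P = 0}

/-- Connectedness in the Zariski topology. -/
def IsZConnected {k : Type} [Field k] {n : ℕ} (G : Set (GL (Fin n) k)) : Prop :=
  ∀ S T : Set (GL (Fin n) k), IsZClosed S → IsZClosed T → G ⊆ S ∪ T →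
    G ∩ (S ∩ T) = ∅ → G ∩ S = ∅ ∨ G ∩ T = ∅

/-- A map `GL n → GL m` is regular on `G` if its coordinates are polynomial
functions of the coordinates of the source. -/
def IsRegularMapOn {k : Type} [Field k] {n m : ℕ} (G : Set (GL (Fin n) k))
    (F : GL (Fin n) k → GL (Fin m) k) : Prop :=
  ∃ P : Coord m → MvPolynomial (Coord n) k,
    ∀ g ∈ G, coords (F g) = fun i => MvPolynomial.eval (coords g) (P i)

/-- `F` is an isogeny from the algebraic group `G` onto the algebraic group `H`:
a regular surjective homomorphism of algebraic groups with finite kernel. -/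
structure IsIsogeny {k : Type} [Field k] {n m : ℕ} (G : Subgroup (GL (Fin n) k))
    (H : Subgroup (GL (Fin m) k)) (F : GL (Fin n) k → GL (Fin m) k) : Prop where
  maps : ∀ g ∈ G, F g ∈ H
  hom : ∀ g ∈ G, ∀ h ∈ G, F (g * h) = F g * F h
  regular : IsRegularMapOn (G : Set (GL (Fin n) k)) F
  surj : ∀ h ∈ H, ∃ g ∈ G, F g = h
  finKer : {g : GL (Fin n) k | g ∈ G ∧ F g = 1}.Finite

section IdentityComponent

open Pointwise TopologicalSpace

variable {X : Type*} [Group X] [TopologicalSpace X]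

theorem isPreirreducible_mul_of_separately_continuous
    (hl : ∀ a : X, Continuous (fun x => a * x)) (hr : ∀ a : X, Continuous (fun x => x * a))
    {A B : Set X} (hA : IsPreirreducible A) (hB : IsPreirreducible B) :
    IsPreirreducible (A * B) := by
  rw [isPreirreducible_iff_isClosed_union_isClosed] at hA hB ⊢
  intro Z₁ Z₂ h₁ h₂ hsub
  have key : ∀ Z : Set X, IsClosed Z → IsClosed {a : X | ∀ b ∈ B, a * b ∈ Z} := by
    intro Z hZ
    have : {a : X | ∀ b ∈ B, a * b ∈ Z} = ⋂ b ∈ B, (fun x => x * b) ⁻¹' Z := by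
      ext; simp
    rw [this]
    exact isClosed_biInter fun b _ => hZ.preimage (hr b)
  have hA' := hA _ _ (key Z₁ h₁) (key Z₂ h₂) (by
    intro a ha
    have := hB _ _ (h₁.preimage (hl a)) (h₂.preimage (hl a)) (by
      intro b hb
      exact hsub (Set.mul_mem_mul ha hb))
    rcases this with h | h
    · exact Or.inl fun b hb => h hb
    · exact Or.inr fun b hb => h hb)
  rcases hA' with h | h
  · left; rintro _ ⟨a, ha, b, hb, rfl⟩; exact h ha b hb
  · right; rintro _ ⟨a, ha, b, hb, rfl⟩; exact h ha b hb

theorem subset_irreducibleComponent_one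
    (hl : ∀ a : X, Continuous (fun x => a * x)) (hr : ∀ a : X, Continuous (fun x => x * a))
    {Z : Set X} (hZ : IsPreirreducible Z) (h1 : (1 : X) ∈ Z) :
    Z ⊆ irreducibleComponent 1 := by
  have hirr := isPreirreducible_mul_of_separately_continuous hl hr hZ
    (isIrreducible_irreducibleComponent (x := (1 : X))).2
  have := eq_irreducibleComponent (x := (1 : X)) hirr (by
    intro x hx
    simpa using Set.mul_mem_mul h1 hx)
  intro z hz
  rw [← this]
  simpa using Set.mul_mem_mul hz (mem_irreducibleComponent (x := (1 : X)))

/-- The irreducible component of the identity, as a subgroup. -/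
def identityComponent (hl : ∀ a : X, Continuous (fun x => a * x))
    (hr : ∀ a : X, Continuous (fun x => x * a)) (hi : Continuous (fun x : X => x⁻¹)) :
    Subgroup X where
  carrier := irreducibleComponent 1
  one_mem' := mem_irreducibleComponent
  mul_mem' {a b} ha hb := by
    have hirr := isPreirreducible_mul_of_separately_continuous hl hr
      (isIrreducible_irreducibleComponent (x := (1 : X))).2
      (isIrreducible_irreducibleComponent (x := (1 : X))).2
    exact subset_irreducibleComponent_one hl hr hirr
      (by simpa using Set.mul_mem_mul (mem_irreducibleComponent (x := (1 : X)))
            (mem_irreducibleComponent (x := (1 : X)))) (Set.mul_mem_mul ha hb)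
  inv_mem' {a} ha := by
    have hirr := (isIrreducible_irreducibleComponent (x := (1 : X))).2.image _ hi.continuousOn
    exact subset_irreducibleComponent_one hl hr hirr
      ⟨1, mem_irreducibleComponent, by simp⟩ ⟨a, ha, rfl⟩

variable (hl : ∀ a : X, Continuous (fun x => a * x))
    (hr : ∀ a : X, Continuous (fun x => x * a)) (hi : Continuous (fun x : X => x⁻¹))

theorem isIrreducible_identityComponent :
    IsIrreducible (identityComponent hl hr hi : Set X) :=
  isIrreducible_irreducibleComponent

theorem isClosed_identityComponent :
    IsClosed (identityComponent hl hr hi : Set X) :=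
  isClosed_irreducibleComponent

theorem map_mem_identityComponent (f : X →* X) (hf : Continuous f) {x : X}
    (hx : x ∈ identityComponent hl hr hi) : f x ∈ identityComponent hl hr hi :=
  subset_irreducibleComponent_one hl hr
    ((isIrreducible_identityComponent hl hr hi).2.image f hf.continuousOn)
    ⟨1, (identityComponent hl hr hi).one_mem, map_one f⟩ ⟨x, hx, rfl⟩

theorem normal_identityComponent : (identityComponent hl hr hi).Normal where
  conj_mem a ha x := by
    have hc : Continuous (MulAut.conj x).toMonoidHom := (hr x⁻¹).comp (hl x)
    exact map_mem_identityComponent hl hr hi _ hc ha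

theorem irreducibleComponent_eq_image (x : X) :
    irreducibleComponent x = (fun y => x * y) '' (identityComponent hl hr hi : Set X) := by
  symm
  refine eq_irreducibleComponent
    ((isIrreducible_identityComponent hl hr hi).2.image _ (hl x).continuousOn) ?_
  intro y hy
  refine ⟨x⁻¹ * y, ?_, by simp⟩
  exact subset_irreducibleComponent_one hl hr
    ((isIrreducible_irreducibleComponent (x := x)).2.image _ (hl x⁻¹).continuousOn)
    ⟨x, mem_irreducibleComponent, by simp⟩ ⟨y, hy, rfl⟩

theorem finiteIndex_identityComponent [NoetherianSpace X] :
    (identityComponent hl hr hi).FiniteIndex := by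
  have hfin : Finite (irreducibleComponents X) :=
    (NoetherianSpace.finite_irreducibleComponents (α := X)).to_subtype
  let f : X → irreducibleComponents X := fun x =>
    ⟨irreducibleComponent x, irreducibleComponent_mem_irreducibleComponents x⟩
  have hf : ∀ x y, f x = f y → x⁻¹ * y ∈ identityComponent hl hr hi := by
    intro x y hxy
    have h : irreducibleComponent x = irreducibleComponent y := congrArg Subtype.val hxy
    have hy : y ∈ irreducibleComponent x := h ▸ mem_irreducibleComponent
    rw [irreducibleComponent_eq_image hl hr hi] at hy
    obtain ⟨z, hz, rfl⟩ := hy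
    simpa using hz
  have : Finite (X ⧸ identityComponent hl hr hi) := by
    refine Finite.of_injective (fun q => f (Quotient.out q)) ?_
    intro q₁ q₂ h
    have := hf _ _ h
    rw [← QuotientGroup.eq] at this
    simpa using this
  exact Subgroup.finiteIndex_of_finite_quotient

theorem isClosed_compl_identityComponent [NoetherianSpace X] :
    IsClosed ((identityComponent hl hr hi : Set X)ᶜ) := by
  have hfin := NoetherianSpace.finite_irreducibleComponents (α := X)
  have : ((identityComponent hl hr hi : Set X)ᶜ) =
      ⋃₀ (irreducibleComponents X \ {irreducibleComponent 1}) := by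
    ext x
    constructor
    · intro hx
      refine ⟨irreducibleComponent x, ⟨irreducibleComponent_mem_irreducibleComponents x, ?_⟩,
        mem_irreducibleComponent⟩
      intro h
      exact hx (show x ∈ irreducibleComponent 1 from
        Set.mem_singleton_iff.1 h ▸ mem_irreducibleComponent)
    · rintro ⟨Z, ⟨hZ, hne⟩, hx⟩ hx1
      apply hne
      have hxe : irreducibleComponent x = irreducibleComponent 1 := by
        rw [irreducibleComponent_eq_image hl hr hi]
        ext y
        constructor
        · rintro ⟨z, hz, rfl⟩
          exact (identityComponent hl hr hi).mul_mem hx1 hz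
        · intro hy
          exact ⟨x⁻¹ * y, (identityComponent hl hr hi).mul_mem
            ((identityComponent hl hr hi).inv_mem hx1) hy, by simp⟩
      rw [Set.mem_singleton_iff, ← hxe]
      have hZ' : IsIrreducible Z := hZ.1
      have hZx : IsIrreducible ((fun y => x⁻¹ * y) '' Z) :=
        hZ'.image _ (hl x⁻¹).continuousOn
      have h2 := subset_irreducibleComponent_one hl hr hZx.2 ⟨x, hx, by simp⟩
      have h3 : Z ⊆ irreducibleComponent x := by
        rw [irreducibleComponent_eq_image hl hr hi]
        intro z hz
        exact ⟨x⁻¹ * z, h2 ⟨z, hz, rfl⟩, by simp⟩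
      exact Set.Subset.antisymm h3 (hZ.2 isIrreducible_irreducibleComponent h3)
  rw [this]
  rw [Set.sUnion_eq_biUnion]
  exact (hfin.subset Set.sdiff_subset).isClosed_biUnion
    fun Z hZ => isClosed_of_mem_irreducibleComponents Z hZ.1

end IdentityComponent

section ZariskiTopology

open TopologicalSpace Topology

variable {X Y σ τ K : Type*} [Field K]

/-- The prime ideal of polynomials vanishing at a point of affine space. -/
def pointPrime (x : σ → K) : PrimeSpectrum (MvPolynomial σ K) :=
  ⟨RingHom.ker (MvPolynomial.eval x), RingHom.ker_isPrime _⟩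

/-- The Zariski topology on a type `X` with coordinate functions `c`. -/
@[reducible] def zariskiTopology (c : X → σ → K) : TopologicalSpace X :=
  TopologicalSpace.induced (fun x => pointPrime (c x)) inferInstance

theorem isClosed_zariskiTopology_iff (c : X → σ → K) (S : Set X) :
    IsClosed[zariskiTopology c] S ↔
      ∃ I : Set (MvPolynomial σ K), S = {x | ∀ P ∈ I, eval (c x) P = 0} := by
  rw [zariskiTopology, isClosed_induced_iff]
  constructor
  · rintro ⟨T, hT, rfl⟩
    obtain ⟨I, rfl⟩ := (PrimeSpectrum.isClosed_iff_zeroLocus T).1 hT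
    exact ⟨I, rfl⟩
  · rintro ⟨I, rfl⟩
    exact ⟨PrimeSpectrum.zeroLocus I, PrimeSpectrum.isClosed_zeroLocus I, rfl⟩

theorem isClosed_zeros (c : X → σ → K) (P : MvPolynomial σ K) :
    IsClosed[zariskiTopology c] {x | eval (c x) P = 0} :=
  (isClosed_zariskiTopology_iff c _).2 ⟨{P}, by simp⟩

theorem noetherianSpace_zariskiTopology [Finite σ] (c : X → σ → K) :
    @NoetherianSpace X (zariskiTopology c) :=
  let _ := zariskiTopology c
  Topology.IsInducing.noetherianSpace (i := fun x => pointPrime (c x)) ⟨rfl⟩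

theorem continuous_of_polynomial (c : X → σ → K) (d : Y → τ → K) (f : X → Y)
    (P : τ → MvPolynomial σ K) (hP : ∀ x i, d (f x) i = eval (c x) (P i)) :
    @Continuous X Y (zariskiTopology c) (zariskiTopology d) f := by
  let _ := zariskiTopology c
  let _ := zariskiTopology d
  rw [continuous_iff_isClosed]
  intro S hS
  obtain ⟨I, rfl⟩ := (isClosed_zariskiTopology_iff d S).1 hS
  refine (isClosed_zariskiTopology_iff c _).2 ⟨(fun Q => bind₁ P Q) '' I, ?_⟩
  ext x
  have : d (f x) = fun i => eval (c x) (P i) := funext (hP x)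
  simp only [Set.preimage_ofPred_eq, Set.mem_ofPred_eq, Set.forall_mem_image, this]
  have h2 : ∀ Q, eval (c x) (bind₁ P Q) = eval (fun i => eval (c x) (P i)) Q := by
    exact fun Q => eval₂Hom_bind₁ _ _ _ _
  simp [h2]

theorem eval_mul_eq_zero_of_isIrreducible (c : X → σ → K) {S : Set X}
    (hS : @IsIrreducible X (zariskiTopology c) S) (P Q : MvPolynomial σ K)
    (h : ∀ x ∈ S, eval (c x) (P * Q) = 0) :
    (∀ x ∈ S, eval (c x) P = 0) ∨ (∀ x ∈ S, eval (c x) Q = 0) := by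
  let _ := zariskiTopology c
  have h2 := (isPreirreducible_iff_isClosed_union_isClosed.1 hS.2) _ _
    (isClosed_zeros c P) (isClosed_zeros c Q)
    (fun x hx => by simpa using h x hx)
  exact h2

/-- The ideal of polynomials vanishing on a set of points. -/
def idealOf (c : X → σ → K) (S : Set X) : Ideal (MvPolynomial σ K) where
  carrier := {P | ∀ x ∈ S, eval (c x) P = 0}
  add_mem' hP hQ x hx := by simp [hP x hx, hQ x hx]
  zero_mem' x _ := by simp
  smul_mem' P Q hQ x hx := by simp [hQ x hx]

theorem mem_idealOf {c : X → σ → K} {S : Set X} {P : MvPolynomial σ K} :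
    P ∈ idealOf c S ↔ ∀ x ∈ S, eval (c x) P = 0 := Iff.rfl

theorem isPrime_idealOf (c : X → σ → K) {S : Set X}
    (hS : @IsIrreducible X (zariskiTopology c) S) : (idealOf c S).IsPrime := by
  let _ := zariskiTopology c
  refine ⟨?_, ?_⟩
  · intro h
    obtain ⟨x, hx⟩ := hS.1
    have : (1 : MvPolynomial σ K) ∈ idealOf c S := by rw [h]; trivial
    simpa using this x hx
  · intro P Q h
    exact eval_mul_eq_zero_of_isIrreducible c hS P Q h

end ZariskiTopology

section GLCoordinates

/-- Coordinates of a product in terms of coordinates of the factors. -/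
def mulCoord {A : Type*} [CommRing A] {n : ℕ} (x y : Coord n → A) : Coord n → A :=
  Sum.elim (fun p => ∑ l, x (Sum.inl (p.1, l)) * y (Sum.inl (l, p.2)))
    (fun p => ∑ l, y (Sum.inr (p.1, l)) * x (Sum.inr (l, p.2)))

/-- Coordinates of the identity matrix. -/
def oneCoord {A : Type*} [CommRing A] {n : ℕ} : Coord n → A :=
  Sum.elim (fun p => (1 : Matrix (Fin n) (Fin n) A) p.1 p.2)
    (fun p => (1 : Matrix (Fin n) (Fin n) A) p.1 p.2)

theorem map_mulCoord {A B : Type*} [CommRing A] [CommRing B] {n : ℕ} (f : A →+* B)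
    (x y : Coord n → A) (i : Coord n) :
    f (mulCoord x y i) = mulCoord (fun j => f (x j)) (fun j => f (y j)) i := by
  rcases i with p | p <;> simp [mulCoord]

theorem map_oneCoord {A B : Type*} [CommRing A] [CommRing B] {n : ℕ} (f : A →+* B)
    (i : Coord n) : f (oneCoord i) = oneCoord i := by
  rcases i with p | p <;> simp [oneCoord, Matrix.one_apply, apply_ite f]

variable {K : Type} [Field K] {n : ℕ}

theorem coords_injective : Function.Injective (coords : GL (Fin n) K → Coord n → K) := by
  intro g h hgh
  ext i j
  exact congrFun hgh (Sum.inl (i, j))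

theorem coords_mul (g h : GL (Fin n) K) : coords (g * h) = mulCoord (coords g) (coords h) := by
  ext (p | p) <;> simp [coords, mulCoord, Matrix.mul_apply, -Matrix.coe_units_inv]

theorem coords_inv (g : GL (Fin n) K) : coords g⁻¹ = fun i => coords g i.swap := by
  ext (p | p) <;> simp [coords, -Matrix.coe_units_inv]

theorem coords_one : coords (1 : GL (Fin n) K) = oneCoord := by
  ext (p | p) <;> simp [coords, oneCoord]

theorem mulCoord_swap_coords (g : GL (Fin n) K) :
    mulCoord (coords g) (fun i => coords g i.swap) = oneCoord := by
  rw [← coords_inv, ← coords_mul, mul_inv_cancel, coords_one]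

theorem exists_coords_eq (x : Coord n → K)
    (hx : mulCoord x (fun i => x i.swap) = oneCoord) : ∃ g : GL (Fin n) K, coords g = x := by
  have h : (Matrix.of fun i j => x (Sum.inl (i, j))) * (Matrix.of fun i j => x (Sum.inr (i, j)))
      = 1 := by
    ext i j
    simpa [mulCoord, oneCoord, Matrix.mul_apply] using congrFun hx (Sum.inl (i, j))
  refine ⟨⟨_, _, h, mul_eq_one_comm.1 h⟩, ?_⟩
  ext (p | p) <;> rfl

variable (Γ : Subgroup (GL (Fin n) K))

/-- Coordinates on a linear group. -/
abbrev subCoords : Γ → Coord n → K := fun g => coords (g : GL (Fin n) K)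

theorem continuous_mul_left_zariski (a : Γ) :
    @Continuous Γ Γ (zariskiTopology (subCoords Γ)) (zariskiTopology (subCoords Γ))
      (fun x => a * x) := by
  refine continuous_of_polynomial _ _ _
    (mulCoord (fun i => C (coords (a : GL (Fin n) K) i)) X) fun x i => ?_
  simp [subCoords, map_mulCoord, coords_mul]

theorem continuous_mul_right_zariski (a : Γ) :
    @Continuous Γ Γ (zariskiTopology (subCoords Γ)) (zariskiTopology (subCoords Γ))
      (fun x => x * a) := by
  refine continuous_of_polynomial _ _ _
    (mulCoord X (fun i => C (coords (a : GL (Fin n) K) i))) fun x i => ?_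
  simp [subCoords, map_mulCoord, coords_mul]

theorem continuous_inv_zariski :
    @Continuous Γ Γ (zariskiTopology (subCoords Γ)) (zariskiTopology (subCoords Γ))
      (fun x => x⁻¹) := by
  refine continuous_of_polynomial _ _ _ (fun i => X i.swap) fun x i => ?_
  simp [subCoords, coords_inv]

end GLCoordinates

section Lifting

open TensorProduct

theorem exists_algHom_of_finiteType (Ω D : Type*) [Field Ω] [IsAlgClosed Ω] [CommRing D]
    [Nontrivial D] [Algebra Ω D] [Algebra.FiniteType Ω D] : Nonempty (D →ₐ[Ω] Ω) := by
  obtain ⟨m, hm⟩ := Ideal.exists_maximal D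
  let _ := Ideal.Quotient.field m
  have : Module.Finite Ω (D ⧸ m) := finite_of_finite_type_of_isJacobsonRing Ω (D ⧸ m)
  have hb : Function.Bijective (Algebra.ofId Ω (D ⧸ m)) :=
    IsAlgClosed.algebraMap_bijective_of_isIntegral (k := Ω) (K := D ⧸ m)
  exact ⟨((AlgEquiv.ofBijective _ hb).symm : (D ⧸ m) →ₐ[Ω] Ω).comp (Ideal.Quotient.mkₐ Ω m)⟩

theorem exists_extension_of_prime {A B Ω : Type*} [CommRing A] [CommRing B] [Field Ω]
    [IsAlgClosed Ω] (f : A →+* B) (hf : f.FiniteType) (ψ : A →+* Ω)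
    (h : (⟨RingHom.ker ψ, RingHom.ker_isPrime ψ⟩ : PrimeSpectrum A) ∈
      Set.range (PrimeSpectrum.comap f)) :
    ∃ ψ' : B →+* Ω, ψ'.comp f = ψ := by
  algebraize [f]
  set p : PrimeSpectrum A := ⟨RingHom.ker ψ, RingHom.ker_isPrime ψ⟩ with hp
  have : p.asIdeal.IsPrime := p.2
  have hn := (PrimeSpectrum.nontrivial_iff_mem_rangeComap (R := A) (S := B) p).2 h
  let θ : p.asIdeal.ResidueField →+* Ω := Ideal.ResidueField.lift p.asIdeal ψ le_rfl (by
    intro x hx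
    simp only [Submonoid.mem_comap, IsUnit.mem_submonoid_iff, isUnit_iff_ne_zero]
    exact hx)
  let _ : Algebra p.asIdeal.ResidueField Ω := θ.toAlgebra
  let D := Ω ⊗[p.asIdeal.ResidueField] (p.asIdeal.ResidueField ⊗[A] B)
  have : Nontrivial D := inferInstance
  have : Algebra.FiniteType Ω D := inferInstance
  obtain ⟨χ⟩ := exists_algHom_of_finiteType Ω D
  let j : B →+* D := (Algebra.TensorProduct.includeRight :
    (p.asIdeal.ResidueField ⊗[A] B) →ₐ[p.asIdeal.ResidueField] D).toRingHom.comp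
      (Algebra.TensorProduct.includeRight : B →ₐ[A] (p.asIdeal.ResidueField ⊗[A] B)).toRingHom
  refine ⟨χ.toRingHom.comp j, ?_⟩
  ext a
  have h1 : j (f a) = algebraMap Ω D (ψ a) := by
    have e1 : (Algebra.TensorProduct.includeRight : B →ₐ[A] (p.asIdeal.ResidueField ⊗[A] B)) (f a)
        = algebraMap _ _ (algebraMap A p.asIdeal.ResidueField a) := by
      have := (Algebra.TensorProduct.includeRight :
        B →ₐ[A] (p.asIdeal.ResidueField ⊗[A] B)).commutes a
      exact this
    change (Algebra.TensorProduct.includeRight :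
      (p.asIdeal.ResidueField ⊗[A] B) →ₐ[p.asIdeal.ResidueField] D) _ = _
    erw [e1, AlgHom.commutes]
    rw [IsScalarTower.algebraMap_apply p.asIdeal.ResidueField Ω D]
    congr 1
    exact Ideal.ResidueField.lift_algebraMap (I := p.asIdeal) ψ _ _ a
  change χ (j (f a)) = ψ a
  rw [h1, AlgHom.commutes]
  rfl

theorem exists_extension_of_isIntegral {A B Ω : Type*} [CommRing A] [CommRing B] [Field Ω]
    [IsAlgClosed Ω] (f : A →+* B) (hf : f.FiniteType) (hi : f.IsIntegral)
    (hinj : Function.Injective f) (ψ : A →+* Ω) : ∃ ψ' : B →+* Ω, ψ'.comp f = ψ :=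
  exists_extension_of_prime f hf ψ (hi.comap_surjective hinj _)

theorem exists_ne_zero_forall_extension {A B : Type*} [CommRing A] [CommRing B]
    [IsNoetherianRing A] [IsDomain A] [IsDomain B] (f : A →+* B) (hf : f.FiniteType)
    (hinj : Function.Injective f) :
    ∃ a : A, a ≠ 0 ∧ ∀ (Ω : Type) [Field Ω] [IsAlgClosed Ω] (ψ : A →+* Ω), ψ a ≠ 0 →
      ∃ ψ' : B →+* Ω, ψ'.comp f = ψ := by
  obtain ⟨S, hS⟩ := PrimeSpectrum.exists_constructibleSetData_iff.2
    (PrimeSpectrum.isConstructible_range_comap (RingHom.FinitePresentation.of_finiteType.1 hf))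
  have hgen : (⊥ : PrimeSpectrum A) ∈ S.toSet := by
    rw [hS]
    refine ⟨⊥, ?_⟩
    ext x
    simp only [PrimeSpectrum.comap_asIdeal, PrimeSpectrum.asIdeal_bot, Ideal.mem_comap,
      Ideal.mem_bot]
    exact map_eq_zero_iff f hinj
  simp only [PrimeSpectrum.ConstructibleSetData.toSet, Set.mem_iUnion] at hgen
  obtain ⟨C, hC, h1, h2⟩ := hgen
  have hg : ∀ i, C.g i = 0 := by
    intro i
    have := h1 ⟨i, rfl⟩
    simpa using this
  refine ⟨C.f, fun h => h2 (by simp [h]), ?_⟩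
  intro Ω _ _ ψ hψ
  refine exists_extension_of_prime f hf ψ ?_
  rw [← hS]
  simp only [PrimeSpectrum.ConstructibleSetData.toSet, Set.mem_iUnion]
  refine ⟨C, hC, ?_, ?_⟩
  · rw [PrimeSpectrum.mem_zeroLocus]
    rintro _ ⟨i, rfl⟩
    simp [hg i]
  · intro h
    rw [PrimeSpectrum.mem_zeroLocus, Set.singleton_subset_iff] at h
    exact hψ h

theorem exists_prime_nonempty_ringHom (B : Type*) [CommRing B] [IsDomain B]
    (hfin : (Int.castRingHom B).FiniteType) :
    ∃ (p : ℕ) (_ : Fact p.Prime), Nonempty (B →+* AlgebraicClosure (ZMod p)) := by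
  have hfin : Algebra.FiniteType ℤ B := RingHom.finiteType_algebraMap.1 hfin
  obtain ⟨q, hq⟩ := CharP.exists B
  rcases CharP.char_is_prime_or_zero B q with hprime | rfl
  · have hfact : Fact q.Prime := ⟨hprime⟩
    let _ : Algebra (ZMod q) B := ZMod.algebra _ q
    have : IsScalarTower ℤ (ZMod q) B := .of_algebraMap_eq' (Subsingleton.elim _ _)
    have : Algebra.FiniteType (ZMod q) B := Algebra.FiniteType.of_restrictScalars_finiteType ℤ _ _
    obtain ⟨a, ha, h⟩ := exists_ne_zero_forall_extension (algebraMap (ZMod q) B)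
      (RingHom.finiteType_algebraMap.2 inferInstance) (algebraMap (ZMod q) B).injective
    obtain ⟨χ, -⟩ := h (AlgebraicClosure (ZMod q)) (algebraMap _ _)
      ((map_ne_zero_iff _ (algebraMap (ZMod q) _).injective).2 ha)
    exact ⟨q, hfact, ⟨χ⟩⟩
  · have : CharZero B := CharP.charP_to_charZero B
    obtain ⟨a, ha, h⟩ := exists_ne_zero_forall_extension (algebraMap ℤ B)
      (RingHom.finiteType_algebraMap.2 hfin) (RingHom.injective_int _)
    obtain ⟨p, hp, hprime⟩ := Nat.exists_infinite_primes (a.natAbs + 1)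
    have : Fact p.Prime := ⟨hprime⟩
    obtain ⟨χ, -⟩ := h (AlgebraicClosure (ZMod p)) (Int.castRingHom _) (by
      rw [eq_intCast, ne_eq, CharP.intCast_eq_zero_iff _ p]
      intro hdvd
      have := Nat.le_of_dvd (Int.natAbs_pos.2 ha) (Int.natCast_dvd.1 hdvd)
      omega)
    exact ⟨p, this, ⟨χ⟩⟩

/-- A nonzero element of a finitely generated domain survives in some algebraic closure of a
prime field. -/
theorem exists_ringHom_algebraicClosure_zmod (R : Type*) [CommRing R] [IsDomain R]
    [Algebra.FiniteType ℤ R] (r : R) (hr : r ≠ 0) :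
    ∃ (p : ℕ) (_ : Fact p.Prime) (σ : R →+* AlgebraicClosure (ZMod p)), σ r ≠ 0 := by
  let B := Localization.Away r
  have : IsDomain B := IsLocalization.isDomain_localization
    (powers_le_nonZeroDivisors_of_noZeroDivisors hr)
  have : Algebra.FiniteType R B := IsLocalization.finiteType_of_monoid_fg (Submonoid.powers r) B
  have h1 : (Int.castRingHom R).FiniteType := RingHom.finiteType_algebraMap.2 inferInstance
  have h2 : (algebraMap R B).FiniteType := RingHom.finiteType_algebraMap.2 inferInstance
  have hfin : (Int.castRingHom B).FiniteType := by
    rw [Subsingleton.elim (Int.castRingHom B) ((algebraMap R B).comp (Int.castRingHom R))]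
    exact h2.comp h1
  obtain ⟨p, hp, ⟨χ⟩⟩ := exists_prime_nonempty_ringHom B hfin
  have : IsUnit (algebraMap R B r) := IsLocalization.Away.algebraMap_isUnit r
  exact ⟨p, hp, χ.comp (algebraMap R B), (this.map χ).ne_zero⟩

end Lifting

section Transcendence

open Cardinal

variable {K S : Type*} [Field K] [CommRing S] [IsDomain S] [Algebra K S]

theorem injective_of_isIntegral_of_injective {d : ℕ} (g₀ g : MvPolynomial (Fin d) K →ₐ[K] S)
    (h₀ : Function.Injective g₀) (hg : g.toRingHom.IsIntegral) : Function.Injective g := by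
  have hind : AlgebraicIndependent K (fun i => g₀ (X i)) := by
    rw [AlgebraicIndependent]
    convert h₀
    ext i
    simp
  have hle := hind.lift_cardinalMk_le_trdeg
  have hge : (aeval fun i => g (X i)) = g := by ext i; simp
  have hadj : (Algebra.adjoin K (Set.range fun i => g (X i))) = g.range := by
    rw [Algebra.adjoin_range_eq_range_aeval, hge]
  have halg : Algebra.IsAlgebraic (Algebra.adjoin K (Set.range fun i => g (X i))) S := by
    rw [hadj]
    have : Algebra.IsIntegral g.range S := by
      constructor
      intro s
      obtain ⟨p, hp, hps⟩ := hg s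
      refine ⟨p.map (g.rangeRestrict : _ →+* g.range), hp.map _, ?_⟩
      rw [Polynomial.eval₂_map]
      exact hps
    infer_instance
  have := Algebra.IsAlgebraic.isTranscendenceBasis_of_lift_le_trdeg_of_finite K
    (fun i => g (X i)) hle
  have h := this.1
  rw [AlgebraicIndependent, hge] at h
  exact h

theorem injective_of_comp_isIntegral {A : Type*} [CommRing A] [Nontrivial A] {T : Type*}
    [CommRing T]
    (g : A →+* S) (hg : g.IsIntegral) (φ : S →+* T)
    (h : Function.Injective (φ.comp g)) : Function.Injective φ := by
  algebraize [g]
  rw [injective_iff_map_eq_zero] at h ⊢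
  intro s hs
  have hbot : RingHom.ker φ = ⊥ := by
    refine Ideal.eq_bot_of_comap_eq_bot (R := A) ?_
    rw [eq_bot_iff]
    intro a ha
    exact h a ha
  have : s ∈ RingHom.ker φ := hs
  rwa [hbot] at this

theorem injective_of_isIntegral_self [Algebra.FiniteType K S] (φ : S →ₐ[K] S)
    (hφ : φ.toRingHom.IsIntegral) : Function.Injective φ := by
  obtain ⟨d, g, hg, hgi⟩ := exists_integral_inj_algHom_of_fg K S
  have h := injective_of_isIntegral_of_injective g (φ.comp g) hg (hgi.trans _ _ hφ)
  exact injective_of_comp_isIntegral g.toRingHom hgi φ.toRingHom h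

end Transcendence

section IntegralPowers

variable {A S ι : Type*} [CommRing A] [CommRing S]

theorem isIntegral_of_pow_eq_linear [Fintype ι] {κ : Type*} [Fintype κ] (f : A →+* S) (u : ι → S)
    (hgen : ∀ s : S, ∃ P : MvPolynomial ι A, eval₂ f u P = s) (Q : ℕ) (hQ : 2 ≤ Q)
    (a : ι → κ → A) (v : ι → κ → ι) (hu : ∀ i, u i ^ Q = ∑ j, f (a i j) * u (v i j)) :
    f.IsIntegral := by
  classical
  algebraize [f]
  have hs : ∀ (x : A) (s : S), x • s = f x * s := fun x s => Algebra.smul_def x s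
  let E : Set (ι →₀ ℕ) := {β | ∀ i, β i < Q}
  have hE : E.Finite := by
    refine (Set.finite_Iic (Finsupp.equivFunOnFinite.symm fun _ => Q)).subset ?_
    intro β hβ i
    exact (hβ i).le
  let mono : (ι →₀ ℕ) → S := fun α => α.prod fun i e => u i ^ e
  let M : Submodule A S := Submodule.span A (mono '' E)
  have madd : ∀ α β, mono (α + β) = mono α * mono β := fun α β =>
    Finsupp.prod_add_index' (by simp) (by intros; rw [pow_add])
  have msingle : ∀ i e, mono (Finsupp.single i e) = u i ^ e := fun i e =>
    Finsupp.prod_single_index (by simp)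
  have key : ∀ N, ∀ α : ι →₀ ℕ, α.degree = N → mono α ∈ M := by
    intro N
    induction N using Nat.strong_induction_on with
    | _ N ih =>
      intro α hα
      by_cases hαE : α ∈ E
      · exact Submodule.subset_span ⟨α, hαE, rfl⟩
      · simp only [E, Set.mem_ofPred_eq, not_forall, not_lt] at hαE
        obtain ⟨i, hi⟩ := hαE
        obtain ⟨β, rfl⟩ : ∃ β, α = Finsupp.single i Q + β :=
          ⟨α - Finsupp.single i Q, (add_tsub_cancel_of_le (by simpa using hi)).symm⟩
        rw [madd, msingle, hu, Finset.sum_mul]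
        refine Submodule.sum_mem _ fun j _ => ?_
        have : f (a i j) * u (v i j) * mono β =
            a i j • mono (Finsupp.single (v i j) 1 + β) := by
          rw [madd, msingle, hs, pow_one, mul_assoc]
        rw [this]
        refine M.smul_mem _ (ih _ ?_ _ rfl)
        rw [← hα, map_add, map_add, Finsupp.degree_single, Finsupp.degree_single]
        omega
  have htop : M = ⊤ := by
    rw [eq_top_iff]
    rintro s -
    obtain ⟨P, rfl⟩ := hgen s
    rw [eval₂_eq']
    refine Submodule.sum_mem _ fun α _ => ?_
    rw [← hs]
    refine M.smul_mem _ ?_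
    have := key _ α rfl
    simpa [mono, Finsupp.prod_fintype] using this
  have hfin : Module.Finite A S := ⟨⟨(hE.image mono).toFinset, by simpa [M] using htop⟩⟩
  intro s
  exact (Algebra.IsIntegral.isIntegral (R := A) s)

end IntegralPowers

section FrobeniusLang

variable {K : Type} [Field K] {n : ℕ}

/-- The entrywise `p ^ m` power map. -/
def glFrobenius (K : Type) [Field K] (n p m : ℕ) [ExpChar K p] : GL (Fin n) K →* GL (Fin n) K :=
  Matrix.GeneralLinearGroup.map (iterateFrobenius K p m)

theorem coords_glFrobenius (p m : ℕ) [ExpChar K p] (g : GL (Fin n) K) (i : Coord n) :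
    coords (glFrobenius K n p m g) i = coords g i ^ p ^ m := by
  rcases i with q | q
  · simp [coords, glFrobenius, iterateFrobenius_def]
  · have h : (glFrobenius K n p m g)⁻¹ = glFrobenius K n p m g⁻¹ := (map_inv _ _).symm
    simp only [coords, Sum.elim_inr]
    rw [h]
    rfl

theorem eval_bind₁' {σ τ : Type*} (x : σ → K) (P : τ → MvPolynomial σ K) (Q : MvPolynomial τ K) :
    eval x (bind₁ P Q) = eval (fun i => eval x (P i)) Q :=
  eval₂Hom_bind₁ _ _ _ _

/-- A point of affine space at which all polynomials vanishing on a closed linear group vanish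
comes from the group. -/
theorem exists_mem_coords_eq (H : Subgroup (GL (Fin n) K))
    (hcl : IsZClosed (H : Set (GL (Fin n) K)))
    (x : Coord n → K) (hx : ∀ P ∈ idealOf coords (H : Set (GL (Fin n) K)), eval x P = 0) :
    ∃ g ∈ H, coords g = x := by
  obtain ⟨g, rfl⟩ := exists_coords_eq x (by
    ext i
    have := hx (mulCoord X (fun i => X i.swap) i - oneCoord i) (by
      intro g _
      have := congrFun (mulCoord_swap_coords g) i
      simp [map_mulCoord, map_oneCoord, this])
    rw [map_sub, map_mulCoord, map_oneCoord, sub_eq_zero] at this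
    simpa using this)
  refine ⟨g, ?_, rfl⟩
  obtain ⟨I, hI⟩ := hcl
  rw [← SetLike.mem_coe, hI]
  intro P hP
  refine hx P fun h hh => ?_
  rw [hI] at hh
  exact hh P hP

theorem frobenius_lang [IsAlgClosed K] (H : Subgroup (GL (Fin n) K))
    (hcl : IsZClosed (H : Set (GL (Fin n) K)))
    (hprime : (idealOf coords (H : Set (GL (Fin n) K))).IsPrime) (p m : ℕ) [ExpChar K p]
    (hQ : 2 ≤ p ^ m) (hΦ : ∀ g ∈ H, glFrobenius K n p m g ∈ H) :
    ∀ b ∈ H, ∃ g ∈ H, glFrobenius K n p m g = b * g := by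
  intro b hb
  set I := idealOf coords (H : Set (GL (Fin n) K)) with hI
  let Λ : Coord n → MvPolynomial (Coord n) K :=
    mulCoord (fun i => X i ^ p ^ m) (fun i => X i.swap)
  have hΛ : ∀ g, (fun i => eval (coords g) (Λ i)) = coords (glFrobenius K n p m g * g⁻¹) := by
    intro g
    ext i
    simp only [Λ, map_mulCoord, coords_mul, coords_inv]
    congr 1 <;> ext j <;> simp [coords_glFrobenius]
  have hmap : ∀ P ∈ I, bind₁ Λ P ∈ I := by
    intro P hP g hg
    rw [eval_bind₁', hΛ]
    exact hP _ (H.mul_mem (hΦ g hg) (H.inv_mem hg))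
  let S := MvPolynomial (Coord n) K ⧸ I
  let φ : S →ₐ[K] S := Ideal.Quotient.liftₐ I ((Ideal.Quotient.mkₐ K I).comp (bind₁ Λ))
    (fun P hP => Ideal.Quotient.eq_zero_iff_mem.2 (hmap P hP))
  have hφ : ∀ P, φ (Ideal.Quotient.mk I P) = Ideal.Quotient.mk I (bind₁ Λ P) := fun P => rfl
  let u : Coord n → S := fun i => Ideal.Quotient.mk I (X i)
  have hΛX : ∀ i, u i ^ p ^ m = mulCoord (fun j => φ (u j)) u i := by
    intro i
    have h1 : mulCoord (fun j => φ (u j)) u i = Ideal.Quotient.mk I (mulCoord Λ X i) := by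
      rw [map_mulCoord]
      simp only [u, hφ, bind₁_X_right]
    rw [h1, ← map_pow, Ideal.Quotient.eq]
    intro g _
    have h2 := congrFun (hΛ g)
    simp only [map_sub, map_pow, eval_X, map_mulCoord, h2, ← coords_mul, inv_mul_cancel_right,
      coords_glFrobenius, sub_self]
  have hint : φ.toRingHom.IsIntegral := by
    refine isIntegral_of_pow_eq_linear (κ := Fin n) φ.toRingHom u ?_ (p ^ m) hQ
      (Sum.elim (fun q l => u (Sum.inl (q.1, l))) (fun q l => u (Sum.inr (l, q.2))))
      (Sum.elim (fun q l => Sum.inl (l, q.2)) (fun q l => Sum.inr (q.1, l))) ?_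
    · intro s
      obtain ⟨P, rfl⟩ := Ideal.Quotient.mk_surjective s
      refine ⟨P.map (algebraMap K S), ?_⟩
      rw [eval₂_map]
      have : (φ.toRingHom.comp (algebraMap K S)) = algebraMap K S := φ.comp_algebraMap
      rw [this, ← aeval_def]
      have h2 : aeval u = Ideal.Quotient.mkₐ K I := by
        ext i
        exact aeval_X _ _
      rw [h2]; rfl
    · rintro (q | q)
      · exact hΛX _
      · rw [hΛX]
        simp only [mulCoord, Sum.elim_inr]
        exact Finset.sum_congr rfl fun l _ => mul_comm _ _
  have hfinK : Algebra.FiniteType K S := inferInstance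
  have hinj : Function.Injective φ := injective_of_isIntegral_self φ hint
  have hftφ : φ.toRingHom.FiniteType := by
    have : (φ.toRingHom.comp (algebraMap K S)).FiniteType := by
      rw [show φ.toRingHom.comp (algebraMap K S) = algebraMap K S from φ.comp_algebraMap]
      exact RingHom.finiteType_algebraMap.2 hfinK
    exact RingHom.FiniteType.of_comp_finiteType this
  let ψ : S →+* K := Ideal.Quotient.lift I (eval (coords b)) (fun P hP => hP b hb)
  obtain ⟨ψ', hψ'⟩ := exists_extension_of_isIntegral φ.toRingHom hftφ hint hinj ψ
  have hψ'K : ψ'.comp (algebraMap K S) = RingHom.id K := by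
    have : φ.toRingHom.comp (algebraMap K S) = algebraMap K S := φ.comp_algebraMap
    rw [← this, ← RingHom.comp_assoc, hψ']
    ext c
    change eval (coords b) (C c) = c
    simp
  have hψ'eval : ∀ P, ψ' (Ideal.Quotient.mk I P) = eval (fun i => ψ' (u i)) P := by
    intro P
    have : ψ'.comp (Ideal.Quotient.mk I) = eval (fun i => ψ' (u i)) := by
      apply MvPolynomial.ringHom_ext
      · intro c
        exact (RingHom.congr_fun hψ'K c).trans (eval_C c).symm
      · intro i; simp [u]
    exact RingHom.congr_fun this P
  obtain ⟨g, hg, hgx⟩ := exists_mem_coords_eq H hcl (fun i => ψ' (u i)) (by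
    intro P hP
    rw [← hψ'eval, Ideal.Quotient.eq_zero_iff_mem.2 hP, map_zero])
  refine ⟨g, hg, ?_⟩
  rw [← mul_inv_eq_iff_eq_mul]
  apply coords_injective
  rw [← hΛ, hgx]
  ext i
  rw [← hψ'eval]
  have : ψ' (φ (u i)) = ψ (u i) := RingHom.congr_fun hψ' (u i)
  simp only [u, hφ, bind₁_X_right] at this
  rw [this]
  change eval (coords b) (X i) = _
  simp

end FrobeniusLang

section Counting

/-- If `F` commutes with `Φ`, both have finitely many fixed points and the Lang map of `Φ` is
surjective, then the fixed points of `Φ` are in the image of the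
Lang map of `F`. -/
theorem exists_inv_mul_eq_of_commute {G : Type*} [Group G] (F Φ : G →* G)
    (hcomm : ∀ g, Φ (F g) = F (Φ g)) (hF : {g | F g = g}.Finite) (hΦ : {g | Φ g = g}.Finite)
    (hlang : ∀ b, ∃ g, Φ g = b * g) (h : G) (hh : Φ h = h) :
    ∃ g, g⁻¹ * F g = h := by
  classical
  choose r hr using hlang
  set A := hF.toFinset with hA
  set B := hΦ.toFinset with hB
  have memA : ∀ a, a ∈ A ↔ F a = a := fun a => by simp [hA]
  have memB : ∀ a, a ∈ B ↔ Φ a = a := fun a => by simp [hB]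
  have key : ∀ a b, b ∈ B → Φ (r a * b) = a * (r a * b) := by
    intro a b hb
    rw [map_mul, hr, (memB b).1 hb, mul_assoc]
  have hinj : ∀ x ∈ A ×ˢ B, ∀ y ∈ A ×ˢ B, r x.1 * x.2 = r y.1 * y.2 → x = y := by
    rintro ⟨a, b⟩ hx ⟨a', b'⟩ hy hxy
    rw [Finset.mem_product] at hx hy
    have h1 := key a b hx.2
    have h2 := key a' b' hy.2
    simp only at hxy
    rw [hxy, h2] at h1
    have h3 : a' = a := mul_right_cancel h1
    subst h3
    simpa using hxy
  let L : G × G → G := fun x => (r x.1 * x.2)⁻¹ * F (r x.1 * x.2)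
  have hmaps : (A ×ˢ B).image L ⊆ B := by
    intro y hy
    obtain ⟨⟨a, b⟩, hx, rfl⟩ := Finset.mem_image.1 hy
    rw [Finset.mem_product] at hx
    rw [memB]
    simp only [L]
    rw [map_mul, map_inv, hcomm, key a b hx.2, map_mul F a, (memA a).1 hx.1]
    group
  have hcard := Finset.card_le_mul_card_image (f := L) (A ×ˢ B) A.card (by
    intro y hy
    obtain ⟨x₀, hx₀, rfl⟩ := Finset.mem_image.1 hy
    refine Finset.card_le_card_of_injOn (fun x => (r x.1 * x.2) * (r x₀.1 * x₀.2)⁻¹) ?_ ?_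
    · intro x hx
      have hx := (Finset.mem_filter.1 hx).2
      simp only [L] at hx
      rw [Finset.mem_coe, memA, map_mul, map_inv, mul_inv_eq_iff_eq_mul,
        inv_mul_eq_iff_eq_mul.1 hx]
      group
    · intro x hx y hy hxy
      exact hinj x (Finset.mem_filter.1 hx).1 y (Finset.mem_filter.1 hy).1 (mul_right_cancel hxy))
  rw [Finset.card_product] at hcard
  have hApos : 0 < A.card := Finset.card_pos.2 ⟨1, by rw [memA, map_one]⟩
  have himg := Finset.eq_of_subset_of_card_le hmaps (Nat.le_of_mul_le_mul_left hcard hApos)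
  have : h ∈ (A ×ˢ B).image L := by rw [himg, memB, hh]
  obtain ⟨x, -, hx⟩ := Finset.mem_image.1 this
  exact ⟨_, hx⟩

theorem exists_forall_pow_eq_self (p : ℕ) [Fact p.Prime] (s : Finset (AlgebraicClosure (ZMod p))) :
    ∃ m, 0 < m ∧ ∀ x ∈ s, x ^ p ^ m = x := by
  let E := IntermediateField.adjoin (ZMod p) (s : Set (AlgebraicClosure (ZMod p)))
  have : FiniteDimensional (ZMod p) E := IntermediateField.finiteDimensional_adjoin
    fun x _ => (Algebra.IsAlgebraic.isAlgebraic x).isIntegral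
  have : Finite E := Module.finite_of_finite (ZMod p)
  let _ := Fintype.ofFinite E
  refine ⟨Module.finrank (ZMod p) E, Module.finrank_pos, fun x hx => ?_⟩
  have h := FiniteField.pow_card (⟨x, IntermediateField.subset_adjoin _ _ hx⟩ : E)
  rw [← Nat.card_eq_fintype_card, Module.natCard_eq_pow_finrank (K := ZMod p), Nat.card_zmod] at h
  exact congrArg Subtype.val h

theorem eval_pow_of_coeff_pow_eq {K : Type*} [Field K] {σ : Type*} (p m : ℕ) [ExpChar K p]
    (x : σ → K) (P : MvPolynomial σ K) (hP : ∀ d ∈ P.support, coeff d P ^ p ^ m = coeff d P) :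
    eval (fun i => x i ^ p ^ m) P = eval x P ^ p ^ m := by
  have h : map (iterateFrobenius K p m) P = P := by
    ext d
    rw [coeff_map, iterateFrobenius_def]
    by_cases hd : d ∈ P.support
    · exact hP d hd
    · rw [notMem_support_iff.1 hd, zero_pow]
      exact pow_ne_zero _ (expChar_pos K p).ne'
  conv_lhs => rw [← h]
  rw [eval_map, ← iterateFrobenius_def, ← eval₂_id, ← coe_eval₂Hom]
  have := eval₂_comp_left (iterateFrobenius K p m) (RingHom.id K) x P
  rw [coe_eval₂Hom, this]
  congr 1

variable {n : ℕ}

/-- **Lang's theorem** over the algebraic closure of a finite field, for endomorphisms with finitely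
many fixed points. -/
theorem lang_algebraicClosure_zmod (p : ℕ) [Fact p.Prime]
    (H : Subgroup (GL (Fin n) (AlgebraicClosure (ZMod p))))
    (hcl : IsZClosed (H : Set (GL (Fin n) (AlgebraicClosure (ZMod p)))))
    (hprime : (idealOf coords (H : Set (GL (Fin n) (AlgebraicClosure (ZMod p))))).IsPrime)
    (F : H →* H) (P : Coord n → MvPolynomial (Coord n) (AlgebraicClosure (ZMod p)))
    (hP : ∀ g : H, coords (F g : GL (Fin n) (AlgebraicClosure (ZMod p))) =
      fun i => eval (coords (g : GL (Fin n) (AlgebraicClosure (ZMod p)))) (P i))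
    (hfix : {g | F g = g}.Finite) (h : H) : ∃ g, g⁻¹ * F g = h := by
  classical
  obtain ⟨gens, hgens⟩ :=
    (inferInstance : IsNoetherianRing (MvPolynomial (Coord n) (AlgebraicClosure (ZMod p)))).noetherian
      (idealOf coords (H : Set (GL (Fin n) (AlgebraicClosure (ZMod p)))))
  let cf : MvPolynomial (Coord n) (AlgebraicClosure (ZMod p)) → Finset (AlgebraicClosure (ZMod p)) :=
    fun Q => Q.support.image fun d => coeff d Q
  obtain ⟨m, hm, hs⟩ := exists_forall_pow_eq_self p
    (gens.biUnion cf ∪ Finset.univ.biUnion (fun i => cf (P i)) ∪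
      Finset.univ.image (coords (h : GL (Fin n) (AlgebraicClosure (ZMod p)))))
  have : CharP (AlgebraicClosure (ZMod p)) p := inferInstance
  have : ExpChar (AlgebraicClosure (ZMod p)) p := inferInstance
  have hcf : ∀ Q, (∀ x ∈ cf Q, x ^ p ^ m = x) → ∀ x : Coord n → AlgebraicClosure (ZMod p),
      eval (fun i => x i ^ p ^ m) Q = eval x Q ^ p ^ m := by
    intro Q hQ x
    exact eval_pow_of_coeff_pow_eq p m x Q fun d hd => hQ _ (Finset.mem_image_of_mem _ hd)
  have hcoords : ∀ g, coords (glFrobenius (AlgebraicClosure (ZMod p)) n p m g) =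
      fun i => coords g i ^ p ^ m := fun g => funext (coords_glFrobenius p m g)
  have hΦ : ∀ g ∈ H, glFrobenius (AlgebraicClosure (ZMod p)) n p m g ∈ H := by
    intro g hg
    obtain ⟨g', hg', he⟩ := exists_mem_coords_eq H hcl
      (coords (glFrobenius (AlgebraicClosure (ZMod p)) n p m g)) (by
        have hle : idealOf coords (H : Set (GL (Fin n) (AlgebraicClosure (ZMod p)))) ≤
            RingHom.ker (eval (coords (glFrobenius (AlgebraicClosure (ZMod p)) n p m g))) := by
          rw [← hgens]
          refine Submodule.span_le.2 fun Q hQ => ?_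
          have hQI : Q ∈ idealOf coords (H : Set (GL (Fin n) (AlgebraicClosure (ZMod p)))) := by
            rw [← hgens]; exact Submodule.subset_span hQ
          change eval _ Q = 0
          rw [hcoords, hcf Q fun x hx => hs x (Finset.mem_union_left _ (Finset.mem_union_left _
            (Finset.mem_biUnion.2 ⟨Q, hQ, hx⟩))), hQI g hg,
            zero_pow (pow_ne_zero _ (expChar_pos (AlgebraicClosure (ZMod p)) p).ne')]
        exact fun Q hQ => hle hQ)
    rwa [← coords_injective he]
  let Φ : H →* H := ((glFrobenius (AlgebraicClosure (ZMod p)) n p m).comp H.subtype).codRestrict H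
    fun g => hΦ g g.2
  have hΦcoords : ∀ g : H, coords (Φ g : GL (Fin n) (AlgebraicClosure (ZMod p))) =
      fun i => coords (g : GL (Fin n) (AlgebraicClosure (ZMod p))) i ^ p ^ m :=
    fun g => hcoords g
  have hext : ∀ g g' : H,
      coords (g : GL (Fin n) (AlgebraicClosure (ZMod p))) =
        coords (g' : GL (Fin n) (AlgebraicClosure (ZMod p))) → g = g' :=
    fun g g' hg => Subtype.ext (coords_injective hg)
  have hfixed : Φ h = h := by
    apply hext
    rw [hΦcoords]
    ext i
    exact hs _ (Finset.mem_union_right _ (Finset.mem_image_of_mem _ (Finset.mem_univ i)))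
  refine exists_inv_mul_eq_of_commute F Φ ?_ hfix ?_ ?_ h hfixed
  · intro g
    apply hext
    rw [hΦcoords, hP, hP, hΦcoords]
    ext i
    rw [hcf (P i)]
    exact fun x hx => hs x (Finset.mem_union_left _ (Finset.mem_union_right _
      (Finset.mem_biUnion.2 ⟨i, Finset.mem_univ _, hx⟩)))
  · have hfin : {x : AlgebraicClosure (ZMod p) | x ^ p ^ m = x}.Finite := by
      have hne : (Polynomial.X ^ p ^ m - Polynomial.X :
          Polynomial (AlgebraicClosure (ZMod p))) ≠ 0 :=
        FiniteField.X_pow_card_pow_sub_X_ne_zero _ hm.ne' (Fact.out : p.Prime).one_lt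
      refine (Polynomial.finite_setOfPred_isRoot hne).subset fun x hx => ?_
      simpa [sub_eq_zero] using hx
    refine ((Set.Finite.pi' fun _ : Coord n => hfin).preimage
      (f := fun g : H => coords (g : GL (Fin n) (AlgebraicClosure (ZMod p))))
      (fun g _ g' _ hg => hext g g' hg)).subset ?_
    intro g hg i
    exact (congrFun (hΦcoords g) i).symm.trans (by rw [show Φ g = g from hg])
  · intro b
    obtain ⟨g, hg, he⟩ := frobenius_lang H hcl hprime p m
      ((Fact.out : p.Prime).two_le.trans (Nat.le_self_pow hm.ne' p)) hΦ b b.2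
    exact ⟨⟨g, hg⟩, Subtype.ext he⟩

end Counting

section Cosets

variable {K : Type} [Field K] {n : ℕ}

theorem eval_bind₁_mulCoord (a x : GL (Fin n) K) (P : MvPolynomial (Coord n) K) :
    eval (coords x) (bind₁ (mulCoord (fun i => C (coords a i)) X) P) = eval (coords (a * x)) P := by
  rw [eval_bind₁']
  congr 2
  ext i
  simp [map_mulCoord, coords_mul]

/-- A nonzero polynomial in functions over which the coordinates are integral, and which are
jointly surjective onto affine space, does not vanish on any coset of an irreducible subgroup of
finite index. -/
theorem exists_mem_coset_eval_ne_zero [IsAlgClosed K] (Γ : Subgroup (GL (Fin n) K))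
    (H : Subgroup Γ) [H.FiniteIndex]
    (hirr : @IsIrreducible Γ (zariskiTopology (subCoords Γ)) H)
    {d : ℕ} (T : Fin d → MvPolynomial (Coord n) K)
    (hsurj : ∀ v : Fin d → K, ∃ x : Γ, (fun j => eval (subCoords Γ x) (T j)) = v)
    (M : Coord n → Polynomial (MvPolynomial (Fin d) K)) (hM : ∀ i, (M i).Monic)
    (hint : ∀ (i : Coord n) (x : Γ), eval (subCoords Γ x)
      ((M i).eval₂ (bind₁ T : MvPolynomial (Fin d) K →ₐ[K] _).toRingHom (X i)) = 0)
    (c : MvPolynomial (Fin d) K) (hc : c ≠ 0) (y : Γ) :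
    ∃ h ∈ H, eval (fun j => eval (subCoords Γ (y * h)) (T j)) c ≠ 0 := by
  classical
  set I := idealOf (subCoords Γ) (H : Set Γ) with hI
  have hprime : I.IsPrime := isPrime_idealOf _ hirr
  let S := MvPolynomial (Coord n) K ⧸ I
  let μ : Γ → MvPolynomial (Coord n) K →ₐ[K] MvPolynomial (Coord n) K := fun y =>
    bind₁ (mulCoord (fun i => C (coords (y : GL (Fin n) K) i)) X)
  have hμ : ∀ (y x : Γ) P, eval (subCoords Γ x) (μ y P) = eval (subCoords Γ (y * x)) P :=
    fun y x P => eval_bind₁_mulCoord _ _ _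
  let θ : Γ → MvPolynomial (Coord n) K →ₐ[K] S := fun y => (Ideal.Quotient.mkₐ K I).comp (μ y)
  have hθ : ∀ y P, θ y P = 0 ↔ ∀ h ∈ H, eval (subCoords Γ (y * h)) P = 0 := by
    intro y P
    change Ideal.Quotient.mk I (μ y P) = 0 ↔ _
    rw [Ideal.Quotient.eq_zero_iff_mem]
    exact forall₂_congr fun h _ => by rw [hμ]
  let g : Γ → MvPolynomial (Fin d) K →ₐ[K] S := fun y => (θ y).comp (bind₁ T)
  have hg : ∀ y P, g y P = 0 ↔ ∀ h ∈ H, eval (fun j => eval (subCoords Γ (y * h)) (T j)) P = 0 := by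
    intro y P
    change θ y (bind₁ T P) = 0 ↔ _
    rw [hθ]
    exact forall₂_congr fun h _ => by rw [eval_bind₁']
  have hgint : ∀ y, (g y).toRingHom.IsIntegral := by
    intro y s
    obtain ⟨Q, rfl⟩ := Ideal.Quotient.mk_surjective s
    have : Ideal.Quotient.mk I Q = θ y (μ y⁻¹ Q) := by
      rw [← sub_eq_zero]
      change Ideal.Quotient.mk I Q - Ideal.Quotient.mk I (μ y (μ y⁻¹ Q)) = 0
      rw [← map_sub, Ideal.Quotient.eq_zero_iff_mem]
      intro x _
      rw [map_sub, hμ, hμ, inv_mul_cancel_left, sub_self]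
    rw [this]
    induction μ y⁻¹ Q using MvPolynomial.induction_on with
    | C a =>
      have : θ y (C a) = (g y).toRingHom (C a) := by
        change θ y (C a) = θ y (bind₁ T (C a))
        rw [bind₁_C_right]
      rw [this]
      exact RingHom.isIntegralElem_map _
    | add P R hP hR => rw [map_add]; exact RingHom.IsIntegralElem.add _ hP hR
    | mul_X P i hP =>
      rw [map_mul]
      refine RingHom.IsIntegralElem.mul _ hP ⟨M i, hM i, ?_⟩
      have h1 : (g y).toRingHom = (θ y).toRingHom.comp (bind₁ T : _ →ₐ[K] _).toRingHom := rfl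
      rw [h1]
      change (M i).eval₂ _ ((θ y).toRingHom (X i)) = 0
      rw [← Polynomial.hom_eval₂]
      exact (hθ y _).2 fun h _ => hint i (y * h)
  obtain ⟨y₀, hy₀⟩ : ∃ y₀, Function.Injective (g y₀) := by
    by_contra! hcon
    have : ∀ y, ∃ P, P ≠ 0 ∧ g y P = 0 := by
      intro y
      by_contra! h
      exact hcon y ((injective_iff_map_eq_zero _).2 fun P hP => by_contra fun h' => h P h' hP)
    choose P hP0 hP using this
    have : Finite (Γ ⧸ H) := inferInstance
    let _ := Fintype.ofFinite (Γ ⧸ H)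
    have hprod : ∏ q : Γ ⧸ H, P q.out = 0 := by
      apply MvPolynomial.funext
      intro v
      obtain ⟨x, rfl⟩ := hsurj v
      rw [map_prod, map_zero]
      refine Finset.prod_eq_zero (Finset.mem_univ (x : Γ ⧸ H)) ?_
      have h1 := (hg _ _).1 (hP (Quotient.out (x : Γ ⧸ H))) ((Quotient.out (x : Γ ⧸ H))⁻¹ * x)
        (QuotientGroup.eq.1 (QuotientGroup.out_eq' _))
      rwa [mul_inv_cancel_left] at h1
    exact Finset.prod_ne_zero_iff.2 (fun q _ => hP0 _) hprod
  have hinj := injective_of_isIntegral_of_injective (g y₀) (g y) hy₀ (hgint y)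
  by_contra! hcon
  exact hc (hinj (by rw [(hg y c).2 hcon, map_zero]))

end Cosets

section IdentityComponentLang

variable {n : ℕ}

theorem exists_subgroup_lang (p : ℕ) [Fact p.Prime]
    (Γ : Subgroup (GL (Fin n) (AlgebraicClosure (ZMod p))))
    (hcl : IsZClosed (Γ : Set (GL (Fin n) (AlgebraicClosure (ZMod p)))))
    (F : Γ →* Γ) (P : Coord n → MvPolynomial (Coord n) (AlgebraicClosure (ZMod p)))
    (hP : ∀ g : Γ, subCoords Γ (F g) = fun i => eval (subCoords Γ g) (P i))
    (hfix : {g | F g = g}.Finite) :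
    ∃ H : Subgroup Γ, H.Normal ∧ H.FiniteIndex ∧
      @IsIrreducible Γ (zariskiTopology (subCoords Γ)) H ∧
      ∀ h ∈ H, ∃ g ∈ H, g⁻¹ * F g = h := by
  let _ := zariskiTopology (subCoords Γ)
  have := noetherianSpace_zariskiTopology (subCoords Γ)
  have hl := continuous_mul_left_zariski Γ
  have hr := continuous_mul_right_zariski Γ
  have hi := continuous_inv_zariski Γ
  set H := identityComponent hl hr hi with hH
  have hirr : IsIrreducible (H : Set Γ) := isIrreducible_identityComponent hl hr hi
  refine ⟨H, normal_identityComponent hl hr hi, finiteIndex_identityComponent hl hr hi, hirr, ?_⟩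
  have hFcont : Continuous F := continuous_of_polynomial _ _ _ P fun x i => congrFun (hP x) i
  have hFH : ∀ x ∈ H, F x ∈ H := fun x hx => map_mem_identityComponent hl hr hi F hFcont hx
  let H' := H.map Γ.subtype
  have hideal : idealOf coords (H' : Set (GL (Fin n) (AlgebraicClosure (ZMod p)))) =
      idealOf (subCoords Γ) (H : Set Γ) := by
    ext Q
    constructor
    · exact fun h x hx => h x ⟨x, hx, rfl⟩
    · rintro h _ ⟨x, hx, rfl⟩
      exact h x hx
  have hcl' : IsZClosed (H' : Set (GL (Fin n) (AlgebraicClosure (ZMod p)))) := by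
    obtain ⟨I, hI⟩ := hcl
    obtain ⟨J, hJ⟩ := (isClosed_zariskiTopology_iff (subCoords Γ) (H : Set Γ)).1
      (isClosed_identityComponent hl hr hi)
    refine ⟨I ∪ J, ?_⟩
    ext x
    constructor
    · rintro ⟨x, hx, rfl⟩ Q (hQ | hQ)
      · have hxΓ := x.2
        rw [← SetLike.mem_coe, hI] at hxΓ
        exact hxΓ Q hQ
      · rw [hJ] at hx
        exact hx Q hQ
    · intro hx
      have hxΓ : x ∈ (Γ : Set _) := by
        rw [hI]
        exact fun Q hQ => hx Q (Or.inl hQ)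
      refine ⟨⟨x, hxΓ⟩, ?_, rfl⟩
      rw [hJ]
      exact fun Q hQ => hx Q (Or.inr hQ)
  have hmem : ∀ x : H', ∃ h : (x : GL (Fin n) (AlgebraicClosure (ZMod p))) ∈ Γ,
      (⟨x, h⟩ : Γ) ∈ H := by
    rintro ⟨_, x, hx, rfl⟩
    exact ⟨x.2, hx⟩
  choose hΓ hHmem using hmem
  let F' : H' →* H' :=
    { toFun := fun x => ⟨F ⟨x, hΓ x⟩, F ⟨x, hΓ x⟩, hFH _ (hHmem x), rfl⟩
      map_one' := Subtype.ext (congrArg (Subtype.val : Γ → _) (map_one F) :)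
      map_mul' := fun x y => Subtype.ext
        (congrArg (Subtype.val : Γ → _) (map_mul F ⟨x, hΓ x⟩ ⟨y, hΓ y⟩) :) }
  intro h hh
  obtain ⟨g, hg⟩ := lang_algebraicClosure_zmod p H' hcl' (hideal ▸ isPrime_idealOf _ hirr) F' P
    (fun g => hP ⟨g, hΓ g⟩) (by
      refine (hfix.preimage (f := fun x : H' => (⟨x, hΓ x⟩ : Γ)) ?_).subset ?_
      · intro x _ y _ hxy
        exact Subtype.ext (congrArg (Subtype.val : Γ → _) hxy :)
      · intro x hx
        exact Subtype.ext (congrArg (Subtype.val : H' → _) hx :)) ⟨h, h, hh, rfl⟩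
  exact ⟨⟨g, hΓ g⟩, hHmem g, Subtype.ext (congrArg (Subtype.val : H' → _) hg :)⟩

/-- Two density statements for the Lang map of a possibly disconnected group over the algebraic
closure of a finite field: its image is dense, and so is the complement if nonempty, as far as
polynomials in a Noether normalization can tell. -/
theorem lang_image_dense (p : ℕ) [Fact p.Prime]
    (Γ : Subgroup (GL (Fin n) (AlgebraicClosure (ZMod p))))
    (hcl : IsZClosed (Γ : Set (GL (Fin n) (AlgebraicClosure (ZMod p)))))
    (F : Γ →* Γ) (P : Coord n → MvPolynomial (Coord n) (AlgebraicClosure (ZMod p)))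
    (hP : ∀ g : Γ, subCoords Γ (F g) = fun i => eval (subCoords Γ g) (P i))
    (hfix : {g | F g = g}.Finite)
    {d : ℕ} (T : Fin d → MvPolynomial (Coord n) (AlgebraicClosure (ZMod p)))
    (hsurj : ∀ v : Fin d → AlgebraicClosure (ZMod p),
      ∃ x : Γ, (fun j => eval (subCoords Γ x) (T j)) = v)
    (M : Coord n → Polynomial (MvPolynomial (Fin d) (AlgebraicClosure (ZMod p))))
    (hM : ∀ i, (M i).Monic)
    (hint : ∀ (i : Coord n) (x : Γ), eval (subCoords Γ x)
      ((M i).eval₂ (bind₁ T : MvPolynomial (Fin d) _ →ₐ[AlgebraicClosure (ZMod p)] _).toRingHom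
        (X i)) = 0)
    (c : MvPolynomial (Fin d) (AlgebraicClosure (ZMod p))) (hc : c ≠ 0) :
    (∃ g, eval (fun j => eval (subCoords Γ (g⁻¹ * F g)) (T j)) c ≠ 0) ∧
      ∀ x, (∀ g, g⁻¹ * F g ≠ x) →
        ∃ y, (∀ g, g⁻¹ * F g ≠ y) ∧ eval (fun j => eval (subCoords Γ y) (T j)) c ≠ 0 := by
  obtain ⟨H, hnormal, hfinite, hirr, hlang⟩ := exists_subgroup_lang p Γ hcl F P hP hfix
  have key := exists_mem_coset_eval_ne_zero Γ H hirr T hsurj M hM hint c hc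
  refine ⟨?_, fun x hx => ?_⟩
  · obtain ⟨h, hh, hne⟩ := key 1
    obtain ⟨g, -, rfl⟩ := hlang h hh
    exact ⟨g, by rwa [one_mul] at hne⟩
  · obtain ⟨h, hh, hne⟩ := key x
    refine ⟨x * h, fun g hg => ?_, hne⟩
    obtain ⟨u, -, hu⟩ := hlang _ (hnormal.conj_mem _ (H.inv_mem hh) (F g))
    refine hx (u * g) ?_
    have h1 : F u = u * (F g * h⁻¹ * (F g)⁻¹) := inv_mul_eq_iff_eq_mul.1 hu
    have h2 : F g = g * (x * h) := inv_mul_eq_iff_eq_mul.1 hg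
    rw [map_mul, h1, h2]
    group

end IdentityComponentLang

section Transfer

variable {R k : Type} [CommRing R] [IsDomain R] [Field k] [IsAlgClosed k] {τ : Type} [Finite τ]

/-- Nullstellensatz over a subring of an algebraically closed field. -/
theorem exists_C_mul_pow_mem_of_isFractionRing (E : Type) [Field E] [Algebra R E]
    [IsFractionRing R E] (ι : R →+* k) (hι : Function.Injective ι)
    (J : Ideal (MvPolynomial τ R)) (Q : MvPolynomial τ R)
    (hQ : ∀ x : τ → k, (∀ P ∈ J, eval₂ ι x P = 0) → eval₂ ι x Q = 0) :
    ∃ (r : R) (N : ℕ), r ≠ 0 ∧ C r * Q ^ N ∈ J := by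
  let ψ : E →+* k := IsFractionRing.lift hι
  have hψ : ∀ r, ψ (algebraMap R E r) = ι r := IsFractionRing.lift_algebraMap hι
  let _ : Algebra (MvPolynomial τ R) (MvPolynomial τ E) := MvPolynomial.algebraMvPolynomial
  set J' : Ideal (MvPolynomial τ E) := J.map (algebraMap (MvPolynomial τ R) (MvPolynomial τ E))
    with hJ'
  have hmap : algebraMap (MvPolynomial τ R) (MvPolynomial τ E) = map (algebraMap R E) := rfl
  have hpow : ∃ N, map (algebraMap R E) Q ^ N ∈ J' := by
    by_contra! hcon
    let A := MvPolynomial τ E ⧸ J'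
    let a : A := Ideal.Quotient.mk J' (map (algebraMap R E) Q)
    let D := Localization.Away a
    have hnontriv : Nontrivial D := by
      rw [← not_subsingleton_iff_nontrivial,
        IsLocalization.subsingleton_iff (S := D) (M := Submonoid.powers a)]
      rintro ⟨N, hN⟩
      refine hcon N ?_
      rw [← Ideal.Quotient.eq_zero_iff_mem, map_pow]
      exact hN
    have : Algebra.FiniteType E A := inferInstance
    have : Algebra.FiniteType A D := IsLocalization.finiteType_of_monoid_fg (Submonoid.powers a) D
    let f : E →+* D := (algebraMap A D).comp (algebraMap E A)
    have hf : f.FiniteType := (RingHom.finiteType_algebraMap.2 ‹Algebra.FiniteType A D›).comp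
      (RingHom.finiteType_algebraMap.2 ‹Algebra.FiniteType E A›)
    obtain ⟨ψ', hψ'⟩ := exists_extension_of_prime f hf ψ (by
      obtain ⟨m, hm⟩ := Ideal.exists_maximal D
      exact ⟨⟨m, hm.isPrime⟩, Subsingleton.elim _ _⟩)
    let x : τ → k := fun i => ψ' (algebraMap A D (Ideal.Quotient.mk J' (X i)))
    have hx : ∀ P, eval₂ ι x P =
        ψ' (algebraMap A D (Ideal.Quotient.mk J' (map (algebraMap R E) P))) := by
      intro P
      have : eval₂Hom ι x = ((ψ'.comp (algebraMap A D)).comp (Ideal.Quotient.mk J')).comp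
          (map (algebraMap R E)) := by
        apply MvPolynomial.ringHom_ext
        · intro r
          have h1 := RingHom.congr_fun hψ' (algebraMap R E r)
          rw [hψ] at h1
          simp only [RingHom.comp_apply, map_C, eval₂Hom_C]
          exact h1.symm
        · intro i
          simp [x]
      exact RingHom.congr_fun this P
    have h0 := hQ x fun P hP => by
      have h1 : map (algebraMap R E) P ∈ J' := Ideal.mem_map_of_mem _ hP
      rw [hx, Ideal.Quotient.eq_zero_iff_mem.2 h1, map_zero, map_zero]
    rw [hx] at h0
    have hunit : IsUnit (algebraMap A D a) := IsLocalization.Away.algebraMap_isUnit a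
    exact (hunit.map ψ').ne_zero h0
  obtain ⟨N, hN⟩ := hpow
  rw [← map_pow, ← hmap, hJ',
    IsLocalization.mem_map_algebraMap_iff ((nonZeroDivisors R).map (C : R →+* MvPolynomial τ R))] at hN
  obtain ⟨⟨⟨b, hb⟩, ⟨_, r, hr, rfl⟩⟩, h⟩ := hN
  rw [← map_mul] at h
  have h' := map_injective _ (IsFractionRing.injective R E) h
  refine ⟨r, N, nonZeroDivisors.ne_zero hr, ?_⟩
  rw [mul_comm]
  exact h' ▸ hb

/-- Polynomial consequences over `k` of a system of polynomial equations with coefficients in a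
Noetherian subring remain true after almost all specializations. -/
theorem exists_forall_eval₂_eq_zero [IsNoetherianRing R] (ι : R →+* k)
    (hι : Function.Injective ι) (J : Ideal (MvPolynomial τ R)) :
    ∃ r : R, r ≠ 0 ∧ ∀ (Ω : Type) [Field Ω] (σ : R →+* Ω), σ r ≠ 0 → ∀ Q : MvPolynomial τ R,
      (∀ x : τ → k, (∀ P ∈ J, eval₂ ι x P = 0) → eval₂ ι x Q = 0) →
      ∀ x : τ → Ω, (∀ P ∈ J, eval₂ σ x P = 0) → eval₂ σ x Q = 0 := by
  let V : Ideal (MvPolynomial τ R) :=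
    ⨅ x : {x : τ → k // ∀ P ∈ J, eval₂ ι x P = 0}, RingHom.ker (eval₂Hom ι x.1)
  have hV : ∀ Q, Q ∈ V ↔ ∀ x : τ → k, (∀ P ∈ J, eval₂ ι x P = 0) → eval₂ ι x Q = 0 := by
    intro Q
    simp [V, RingHom.mem_ker]
  obtain ⟨gens, hgens⟩ := (inferInstance : IsNoetherianRing (MvPolynomial τ R)).noetherian V
  have hmem : ∀ Q ∈ gens, Q ∈ V := fun Q hQ => hgens ▸ Submodule.subset_span hQ
  choose! r N hr hrN using fun Q (hQ : Q ∈ gens) =>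
    exists_C_mul_pow_mem_of_isFractionRing (FractionRing R) ι hι J Q ((hV Q).1 (hmem Q hQ))
  refine ⟨∏ Q ∈ gens, r Q, Finset.prod_ne_zero_iff.2 hr, fun Ω _ σ hσ Q hQ x hx => ?_⟩
  have hle : V ≤ RingHom.ker (eval₂Hom σ x) := by
    rw [← hgens]
    refine Submodule.span_le.2 fun Q hQ => ?_
    have h := hx _ (hrN Q hQ)
    rw [map_prod] at hσ
    rw [eval₂_mul, eval₂_C, eval₂_pow] at h
    exact eq_zero_of_pow_eq_zero
      ((mul_eq_zero.1 h).resolve_left (Finset.prod_ne_zero_iff.1 hσ Q hQ))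
  exact hle ((hV Q).2 hQ)

theorem exists_forall_eval₂_eq_zero_of_set [IsNoetherianRing R] (ι : R →+* k)
    (hι : Function.Injective ι) (s : Set (MvPolynomial τ R)) :
    ∃ r : R, r ≠ 0 ∧ ∀ (Ω : Type) [Field Ω] (σ : R →+* Ω), σ r ≠ 0 → ∀ Q : MvPolynomial τ R,
      (∀ x : τ → k, (∀ P ∈ s, eval₂ ι x P = 0) → eval₂ ι x Q = 0) →
      ∀ x : τ → Ω, (∀ P ∈ s, eval₂ σ x P = 0) → eval₂ σ x Q = 0 := by
  obtain ⟨r, hr, h⟩ := exists_forall_eval₂_eq_zero ι hι (Ideal.span s)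
  refine ⟨r, hr, fun Ω _ σ hσ Q hQ x hx => h Ω σ hσ Q
    (fun y hy => hQ y fun P hP => hy P (Ideal.subset_span hP)) x fun P hP => ?_⟩
  have hle : Ideal.span s ≤ RingHom.ker (eval₂Hom σ x) := Ideal.span_le.2 hx
  exact hle hP

end Transfer

section Specialization

variable {R : Type} [CommRing R]

theorem eval₂_bind₁' {A : Type*} [CommRing A] (f : R →+* A) {τ υ : Type*} (x : υ → A)
    (P : τ → MvPolynomial υ R) (Q : MvPolynomial τ R) :
    eval₂ f x (bind₁ P Q) = eval₂ f (fun i => eval₂ f x (P i)) Q :=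
  eval₂Hom_bind₁ _ _ _ _

theorem eval₂_mulCoord {A : Type*} [CommRing A] (f : R →+* A) {τ : Type*} {n : ℕ} (x : τ → A)
    (u v : Coord n → MvPolynomial τ R) (i : Coord n) :
    eval₂ f x (mulCoord u v i) =
      mulCoord (fun j => eval₂ f x (u j)) (fun j => eval₂ f x (v j)) i :=
  map_mulCoord (eval₂Hom f x) u v i

theorem eval₂_oneCoord {A : Type*} [CommRing A] (f : R →+* A) {τ : Type*} {n : ℕ} (x : τ → A)
    (i : Coord n) : eval₂ f x (oneCoord i) = oneCoord i :=
  map_oneCoord (eval₂Hom f x) i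

variable {k : Type} [Field k]

/-- Polynomials with coefficients in `R` vanishing on a family of points over `k`. -/
def vanishingIdealOver {X τ : Type*} (ι : R →+* k) (c : X → τ → k) : Ideal (MvPolynomial τ R) :=
  ⨅ x, RingHom.ker (eval₂Hom ι (c x))

theorem mem_vanishingIdealOver {X τ : Type*} {ι : R →+* k} {c : X → τ → k}
    {P : MvPolynomial τ R} : P ∈ vanishingIdealOver ι c ↔ ∀ x, eval₂ ι (c x) P = 0 := by
  simp [vanishingIdealOver, RingHom.mem_ker]

/-- The points of the specialization of a linear group come from invertible matrices. -/
theorem exists_coords_eq_of_vanishing {Ω : Type} [Field Ω] {n : ℕ} (G : Subgroup (GL (Fin n) k))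
    (ι : R →+* k) (σ : R →+* Ω) (x : Coord n → Ω)
    (hx : ∀ Q ∈ vanishingIdealOver ι (subCoords G), eval₂ σ x Q = 0) : ∃ g, coords g = x := by
  refine exists_coords_eq x ?_
  ext i
  have := hx (mulCoord X (fun i => X i.swap) i - oneCoord i) (mem_vanishingIdealOver.2 fun g => by
    have := congrFun (mulCoord_swap_coords (g : GL (Fin n) k)) i
    simp [eval₂_mulCoord, eval₂_oneCoord, this, subCoords])
  rw [eval₂_sub, eval₂_mulCoord, eval₂_oneCoord, sub_eq_zero] at this
  simpa using this

/-- A linear group with an endomorphism defined over a finitely generated ring `R` specializes,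
at almost all points of `R`, to a linear group with an endomorphism with analogous properties. -/
theorem exists_specialization [IsDomain R] [IsNoetherianRing R] [IsAlgClosed k] {n : ℕ}
    (ι : R →+* k) (hι : Function.Injective ι) (G : Subgroup (GL (Fin n) k))
    (hG : ∀ x : Coord n → k, (∀ Q ∈ vanishingIdealOver ι (subCoords G), eval₂ ι x Q = 0) →
      ∃ g : G, subCoords G g = x)
    (F : G →* G) (P : Coord n → MvPolynomial (Coord n) R)
    (hP : ∀ g, subCoords G (F g) = fun i => eval₂ ι (subCoords G g) (P i))
    (q : Coord n → Polynomial R) (hq : ∀ i, (q i).Monic)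
    (hfix : ∀ g, F g = g → ∀ i, (q i).eval₂ ι (subCoords G g i) = 0)
    (h₀ : G) (η : Coord n → R) (hη : subCoords G h₀ = fun i => ι (η i))
    (hh₀ : ∀ g, g⁻¹ * F g ≠ h₀) :
    ∃ r : R, r ≠ 0 ∧ ∀ (Ω : Type) [Field Ω] (σ : R →+* Ω), σ r ≠ 0 →
      ∃ (Γ : Subgroup (GL (Fin n) Ω)) (F' : Γ →* Γ) (h : Γ),
        (∀ g, g ∈ Γ ↔ ∀ Q ∈ vanishingIdealOver ι (subCoords G), eval₂ σ (coords g) Q = 0) ∧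
        (∀ g, subCoords Γ (F' g) = fun i => eval₂ σ (subCoords Γ g) (P i)) ∧
        {g | F' g = g}.Finite ∧ ∀ g, g⁻¹ * F' g ≠ h := by
  classical
  set I := vanishingIdealOver ι (subCoords G) with hI
  have hGext : ∀ g g' : G, subCoords G g = subCoords G g' → g = g' :=
    fun g g' h => Subtype.ext (coords_injective h)
  let XL : Coord n → MvPolynomial (Coord n ⊕ Coord n) R := fun i => X (Sum.inl i)
  let XR : Coord n → MvPolynomial (Coord n ⊕ Coord n) R := fun i => X (Sum.inr i)
  obtain ⟨r₁, hr₁, H₁⟩ := exists_forall_eval₂_eq_zero_of_set ι hι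
    (bind₁ XL '' I ∪ bind₁ XR '' I)
  obtain ⟨r₂, hr₂, H₂⟩ := exists_forall_eval₂_eq_zero_of_set ι hι
    ((I : Set (MvPolynomial (Coord n) R)) ∪ Set.range fun i => P i - X i)
  obtain ⟨r₃, hr₃, H₃⟩ := exists_forall_eval₂_eq_zero_of_set ι hι
    ((I : Set (MvPolynomial (Coord n) R)) ∪
      Set.range fun i => P i - mulCoord X (fun j => C (η j)) i)
  refine ⟨r₁ * r₂ * r₃, mul_ne_zero (mul_ne_zero hr₁ hr₂) hr₃, fun Ω _ σ hσ => ?_⟩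
  rw [map_mul, map_mul] at hσ
  have hσ₁ := left_ne_zero_of_mul (left_ne_zero_of_mul hσ)
  have hσ₂ := right_ne_zero_of_mul (left_ne_zero_of_mul hσ)
  have hσ₃ := right_ne_zero_of_mul hσ
  -- two-variable identities
  have two : ∀ Q : MvPolynomial (Coord n ⊕ Coord n) R,
      (∀ g g' : G, eval₂ ι (Sum.elim (subCoords G g) (subCoords G g')) Q = 0) →
      ∀ x y : Coord n → Ω, (∀ Q ∈ I, eval₂ σ x Q = 0) → (∀ Q ∈ I, eval₂ σ y Q = 0) →
        eval₂ σ (Sum.elim x y) Q = 0 := by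
    intro Q hQ x y hx hy
    refine H₁ Ω σ hσ₁ Q (fun z hz => ?_) _ ?_
    · obtain ⟨g, hg⟩ := hG (fun i => z (Sum.inl i)) fun Q hQ => by
        have := hz _ (Or.inl ⟨Q, hQ, rfl⟩)
        rw [eval₂_bind₁'] at this
        simpa [XL] using this
      obtain ⟨g', hg'⟩ := hG (fun i => z (Sum.inr i)) fun Q hQ => by
        have := hz _ (Or.inr ⟨Q, hQ, rfl⟩)
        rw [eval₂_bind₁'] at this
        simpa [XR] using this
      have := hQ g g'
      rw [hg, hg'] at this
      convert this
      ext (i | i) <;> rfl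
    · rintro _ (⟨Q, hQ, rfl⟩ | ⟨Q, hQ, rfl⟩)
      · rw [eval₂_bind₁']
        simpa [XL] using hx Q hQ
      · rw [eval₂_bind₁']
        simpa [XR] using hy Q hQ
  let Γ : Subgroup (GL (Fin n) Ω) :=
    { carrier := {g | ∀ Q ∈ I, eval₂ σ (coords g) Q = 0}
      mul_mem' := by
        intro x y hx hy Q hQ
        have := two (bind₁ (mulCoord XL XR) Q) (fun g g' => by
          rw [eval₂_bind₁']
          have := mem_vanishingIdealOver.1 hQ (g * g')
          rw [show subCoords G (g * g') = _ from coords_mul _ _] at this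
          simpa [eval₂_mulCoord, XL, XR] using this) _ _ hx hy
        rw [eval₂_bind₁'] at this
        rw [coords_mul]
        simpa [eval₂_mulCoord, XL, XR] using this
      one_mem' := by
        intro Q hQ
        have := mem_vanishingIdealOver.1 hQ 1
        rw [show subCoords G 1 = _ from coords_one] at this
        have h1 : ∀ {A : Type} [CommRing A] (f : R →+* A),
            eval₂ f oneCoord Q = f (eval oneCoord Q) := by
          intro A _ f
          rw [← eval₂_id, ← coe_eval₂Hom (RingHom.id R), coe_eval₂Hom, eval₂_comp_left]
          congr 1
          ext i
          exact (map_oneCoord f i).symm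
        rw [h1, map_eq_zero_iff ι hι] at this
        rw [coords_one, h1, this, map_zero]
      inv_mem' := by
        intro x hx Q hQ
        have := hx (bind₁ (fun i => X i.swap) Q) (mem_vanishingIdealOver.2 fun g => by
          rw [eval₂_bind₁']
          have := mem_vanishingIdealOver.1 hQ g⁻¹
          rw [show subCoords G g⁻¹ = _ from coords_inv _] at this
          simpa using this)
        rw [eval₂_bind₁'] at this
        rw [coords_inv]
        simpa using this }
  have hΓ : ∀ g, g ∈ Γ ↔ ∀ Q ∈ I, eval₂ σ (coords g) Q = 0 := fun g => Iff.rfl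
  have hΓext : ∀ g g' : Γ, subCoords Γ g = subCoords Γ g' → g = g' :=
    fun g g' h => Subtype.ext (coords_injective h)
  have hpt : ∀ x : Coord n → Ω, (∀ Q ∈ I, eval₂ σ x Q = 0) → ∃ g : Γ, subCoords Γ g = x := by
    intro x hx
    obtain ⟨g, rfl⟩ := exists_coords_eq_of_vanishing G ι σ x hx
    exact ⟨⟨g, hx⟩, rfl⟩
  have hF : ∀ g : Γ, ∃ g' : Γ, subCoords Γ g' = fun i => eval₂ σ (subCoords Γ g) (P i) := by
    intro g
    refine hpt _ fun Q hQ => ?_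
    rw [← eval₂_bind₁']
    refine g.2 _ (mem_vanishingIdealOver.2 fun x => ?_)
    rw [eval₂_bind₁', ← hP]
    exact mem_vanishingIdealOver.1 hQ _
  choose f hf using hF
  let F' : Γ →* Γ := MonoidHom.mk' f (by
    intro x y
    apply hΓext
    ext i
    have := two (bind₁ (mulCoord XL XR) (P i) -
        mulCoord (fun j => bind₁ XL (P j)) (fun j => bind₁ XR (P j)) i) (fun g g' => by
      have := congrFun (hP (g * g')) i
      rw [map_mul, show subCoords G (F g * F g') = _ from coords_mul _ _,
        show subCoords G (g * g') = _ from coords_mul _ _] at this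
      change mulCoord (subCoords G (F g)) (subCoords G (F g')) i = _ at this
      rw [hP, hP] at this
      rw [eval₂_sub, eval₂_bind₁', sub_eq_zero]
      simp only [eval₂_mulCoord, eval₂_bind₁', XL, XR, eval₂_X, Sum.elim_inl, Sum.elim_inr]
      exact this.symm) _ _ x.2 y.2
    rw [eval₂_sub, eval₂_bind₁', sub_eq_zero] at this
    simp only [eval₂_mulCoord, eval₂_bind₁', XL, XR, eval₂_X, Sum.elim_inl, Sum.elim_inr] at this
    rw [hf, show subCoords Γ (f x * f y) = _ from coords_mul _ _]
    change _ = mulCoord (subCoords Γ (f x)) (subCoords Γ (f y)) i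
    rw [hf, hf, show subCoords Γ (x * y) = _ from coords_mul _ _]
    exact this)
  have hF' : ∀ g, subCoords Γ (F' g) = fun i => eval₂ σ (subCoords Γ g) (P i) := hf
  obtain ⟨h, hh⟩ := hpt (fun i => σ (η i)) fun Q hQ => by
    have := mem_vanishingIdealOver.1 hQ h₀
    have h1 : ∀ {A : Type} [CommRing A] (f : R →+* A),
        eval₂ f (fun i => f (η i)) Q = f (eval η Q) := by
      intro A _ f
      rw [← eval₂_id, ← coe_eval₂Hom (RingHom.id R), coe_eval₂Hom, eval₂_comp_left]
      congr 1
    rw [hη, h1, map_eq_zero_iff ι hι] at this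
    rw [h1, this, map_zero]
  refine ⟨Γ, F', h, hΓ, hF', ?_, ?_⟩
  · have hroot : ∀ g, F' g = g → ∀ i, (q i).eval₂ σ (subCoords Γ g i) = 0 := by
      intro g hg i
      have h2 : ∀ {A : Type} [CommRing A] (f : R →+* A) (x : Coord n → A),
          eval₂ f x (Polynomial.aeval (X i) (q i)) = (q i).eval₂ f (x i) := by
        intro A _ f x
        rw [Polynomial.aeval_def, ← coe_eval₂Hom, Polynomial.hom_eval₂]
        congr 1
        · ext; simp [algebraMap_eq]
        · simp
      rw [← h2]
      refine H₂ Ω σ hσ₂ _ (fun x hx => ?_) _ ?_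
      · obtain ⟨g, rfl⟩ := hG x fun Q hQ => hx Q (Or.inl hQ)
        rw [h2]
        refine hfix g (hGext _ _ ?_) i
        ext j
        have := hx _ (Or.inr ⟨j, rfl⟩)
        rwa [eval₂_sub, eval₂_X, sub_eq_zero, ← congrFun (hP g) j] at this
      · rintro _ (hQ | ⟨j, rfl⟩)
        · exact g.2 _ hQ
        · rw [eval₂_sub, eval₂_X, sub_eq_zero, ← congrFun (hF' g) j, hg]
    have hfin : ∀ i, {x : Ω | (q i).eval₂ σ x = 0}.Finite := fun i => by
      refine (Polynomial.finite_setOfPred_isRoot ((hq i).map σ).ne_zero).subset fun x hx => ?_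
      simpa [Polynomial.eval_map] using hx
    refine ((Set.Finite.pi' hfin).preimage (f := fun g : Γ => subCoords Γ g)
      (fun g _ g' _ hg => hΓext g g' hg)).subset fun g hg i => hroot g hg i
  · intro g hg
    have := H₃ Ω σ hσ₃ 1 (fun x hx => ?_) (subCoords Γ g) ?_
    · simp at this
    · obtain ⟨g, rfl⟩ := hG x fun Q hQ => hx Q (Or.inl hQ)
      refine absurd ?_ (hh₀ g)
      rw [inv_mul_eq_iff_eq_mul]
      apply hGext
      rw [show subCoords G (g * h₀) = _ from coords_mul _ _]
      change _ = mulCoord (subCoords G g) (subCoords G h₀)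
      ext j
      have := hx _ (Or.inr ⟨j, rfl⟩)
      rw [eval₂_sub, eval₂_mulCoord, sub_eq_zero, ← congrFun (hP g) j] at this
      rw [hη]
      simpa using this
    · rintro _ (hQ | ⟨j, rfl⟩)
      · exact g.2 _ hQ
      · rw [eval₂_sub, eval₂_mulCoord, sub_eq_zero, ← congrFun (hF' g) j,
          inv_mul_eq_iff_eq_mul.1 hg, show subCoords Γ (g * h) = _ from coords_mul _ _]
        change mulCoord (subCoords Γ g) (subCoords Γ h) j = _
        rw [hh]
        simp

end Specialization

section LangMap

variable {R : Type} [CommRing R] {n : ℕ}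

/-- The coordinates of the Lang map, given those of the endomorphism. -/
def langPoly (P : Coord n → MvPolynomial (Coord n) R) : Coord n → MvPolynomial (Coord n) R :=
  mulCoord (fun i => X i.swap) P

theorem eval₂_langPoly {Ω : Type} [Field Ω] (σ : R →+* Ω) (Γ : Subgroup (GL (Fin n) Ω)) (F : Γ →* Γ)
    (P : Coord n → MvPolynomial (Coord n) R)
    (hP : ∀ g, subCoords Γ (F g) = fun i => eval₂ σ (subCoords Γ g) (P i)) (g : Γ) :
    (fun i => eval₂ σ (subCoords Γ g) (langPoly P i)) = subCoords Γ (g⁻¹ * F g) := by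
  rw [show subCoords Γ (g⁻¹ * F g) = _ from coords_mul _ _]
  change _ = mulCoord (coords ((g : GL (Fin n) Ω)⁻¹)) (subCoords Γ (F g))
  rw [coords_inv, hP]
  ext i
  simp [langPoly, eval₂_mulCoord]

theorem isIntegral_quotient_of_monic {d : ℕ} (I : Ideal (MvPolynomial (Coord n) R))
    (T : Fin d → MvPolynomial (Coord n) R) (M : Coord n → Polynomial (MvPolynomial (Fin d) R))
    (hM : ∀ i, (M i).Monic)
    (hint : ∀ i, (M i).eval₂ (bind₁ T : MvPolynomial (Fin d) R →ₐ[R] _).toRingHom (X i) ∈ I) :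
    ((Ideal.Quotient.mk I).comp (bind₁ T : MvPolynomial (Fin d) R →ₐ[R] _).toRingHom).IsIntegral := by
  intro s
  obtain ⟨Q, rfl⟩ := Ideal.Quotient.mk_surjective s
  induction Q using MvPolynomial.induction_on with
  | C a =>
    have : Ideal.Quotient.mk I (C a) = ((Ideal.Quotient.mk I).comp
        (bind₁ T : MvPolynomial (Fin d) R →ₐ[R] _).toRingHom) (C a) := by
      change _ = Ideal.Quotient.mk I (bind₁ T (C a))
      rw [bind₁_C_right]
    rw [this]
    exact RingHom.isIntegralElem_map _
  | add P R hP hR => rw [map_add]; exact RingHom.IsIntegralElem.add _ hP hR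
  | mul_X P i hP =>
    rw [map_mul]
    refine RingHom.IsIntegralElem.mul _ hP ⟨M i, hM i, ?_⟩
    rw [← Polynomial.hom_eval₂]
    exact Ideal.Quotient.eq_zero_iff_mem.2 (hint i)

/-- There is no counterexample to the Lang–Steinberg theorem defined over a finitely generated
ring, with a Noether normalization over that ring. -/
theorem false_of_arithmetic_counterexample {k : Type} [Field k] [IsAlgClosed k] [IsDomain R]
    [Algebra.FiniteType ℤ R]
    (ι : R →+* k) (hι : Function.Injective ι) (G : Subgroup (GL (Fin n) k))
    (hG : ∀ x : Coord n → k, (∀ Q ∈ vanishingIdealOver ι (subCoords G), eval₂ ι x Q = 0) →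
      ∃ g : G, subCoords G g = x)
    (hprime : (vanishingIdealOver ι (subCoords G)).IsPrime)
    (F : G →* G) (P : Coord n → MvPolynomial (Coord n) R)
    (hP : ∀ g, subCoords G (F g) = fun i => eval₂ ι (subCoords G g) (P i))
    (q : Coord n → Polynomial R) (hq : ∀ i, (q i).Monic)
    (hfix : ∀ g, F g = g → ∀ i, (q i).eval₂ ι (subCoords G g i) = 0)
    (h₀ : G) (η : Coord n → R) (hη : subCoords G h₀ = fun i => ι (η i))
    (hh₀ : ∀ g, g⁻¹ * F g ≠ h₀)
    {d : ℕ} (T : Fin d → MvPolynomial (Coord n) R)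
    (hT : ∀ c, bind₁ T c ∈ vanishingIdealOver ι (subCoords G) → c = 0)
    (M : Coord n → Polynomial (MvPolynomial (Fin d) R)) (hM : ∀ i, (M i).Monic)
    (hint : ∀ i, (M i).eval₂ (bind₁ T : MvPolynomial (Fin d) R →ₐ[R] _).toRingHom (X i) ∈
      vanishingIdealOver ι (subCoords G)) : False := by
  classical
  have hnoeth : IsNoetherianRing R := Algebra.FiniteType.isNoetherianRing ℤ R
  obtain ⟨r, hr, hspec⟩ := exists_specialization ι hι G hG F P hP q hq hfix h₀ η hη hh₀
  set I := vanishingIdealOver ι (subCoords G) with hI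
  let S := MvPolynomial (Coord n) R ⧸ I
  let g : MvPolynomial (Fin d) R →+* S :=
    (Ideal.Quotient.mk I).comp (bind₁ T : MvPolynomial (Fin d) R →ₐ[R] _).toRingHom
  have hg : ∀ c, g c = Ideal.Quotient.mk I (bind₁ T c) := fun c => rfl
  have hgint : g.IsIntegral := isIntegral_quotient_of_monic I T M hM hint
  have hginj : Function.Injective g := (injective_iff_map_eq_zero g).2 fun c hc =>
    hT c (Ideal.Quotient.eq_zero_iff_mem.1 hc)
  have hSft : Algebra.FiniteType R S := inferInstance
  have hft : ∀ {A : Type} [CommRing A] [Algebra R A] (f : A →+* S),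
      f.comp (algebraMap R A) = algebraMap R S → f.FiniteType := by
    intro A _ _ f hf
    have : (f.comp (algebraMap R A)).FiniteType := by
      rw [hf]
      exact RingHom.finiteType_algebraMap.2 hSft
    exact RingHom.FiniteType.of_comp_finiteType this
  have hgft : g.FiniteType := hft g (by
    ext a
    change Ideal.Quotient.mk I (bind₁ T (C a)) = _
    rw [bind₁_C_right]
    rfl)
  -- homomorphisms from `S` are points
  have hpts : ∀ {Ω : Type} [Field Ω] (σ : R →+* Ω) (ψ : S →+* Ω),
      ψ.comp (algebraMap R S) = σ → ∀ Q,
      ψ (Ideal.Quotient.mk I Q) = eval₂ σ (fun i => ψ (Ideal.Quotient.mk I (X i))) Q := by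
    intro Ω _ σ ψ hψ Q
    have : ψ.comp (Ideal.Quotient.mk I) =
        eval₂Hom σ (fun i => ψ (Ideal.Quotient.mk I (X i))) := by
      apply MvPolynomial.ringHom_ext
      · intro a
        rw [eval₂Hom_C]
        exact RingHom.congr_fun hψ a
      · intro i
        simp
    exact RingHom.congr_fun this Q
  have hpts0 : ∀ {Ω : Type} [Field Ω] (σ : R →+* Ω) (ψ : S →+* Ω),
      ψ.comp (algebraMap R S) = σ →
      ∀ Q ∈ I, eval₂ σ (fun i => ψ (Ideal.Quotient.mk I (X i))) Q = 0 := by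
    intro Ω _ σ ψ hψ Q hQ
    rw [← hpts σ ψ hψ, Ideal.Quotient.eq_zero_iff_mem.2 hQ, map_zero]
  have key : ∀ Q, Q ∉ I → bind₁ (langPoly P) Q ∉ I ∧
      ∃ (Ω : Type) (_ : Field Ω) (_ : IsAlgClosed Ω) (σ : R →+* Ω) (y : Coord n → Ω),
        (∀ Q ∈ I, eval₂ σ y Q = 0) ∧ eval₂ σ y Q ≠ 0 ∧
        ∀ x : Coord n → Ω, (∀ Q ∈ I, eval₂ σ x Q = 0) →
          (fun i => eval₂ σ x (langPoly P i)) ≠ y := by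
    intro Q hQ
    obtain ⟨c, hc, Q', hQ'⟩ : ∃ c, c ≠ 0 ∧ ∃ Q', bind₁ T c - Q * Q' ∈ I := by
      have hne : (Ideal.span {Ideal.Quotient.mk I Q}).comap g ≠ ⊥ := by
        algebraize [g]
        exact Ideal.comap_ne_bot_of_integral_mem
          (mt Ideal.Quotient.eq_zero_iff_mem.1 hQ) (Ideal.mem_span_singleton_self _)
          (hgint _)
      obtain ⟨c, hc, hc0⟩ := Submodule.exists_mem_ne_zero_of_ne_bot hne
      obtain ⟨s, hs⟩ := Ideal.mem_span_singleton'.1 (Ideal.mem_comap.1 hc)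
      obtain ⟨Q', rfl⟩ := Ideal.Quotient.mk_surjective s
      refine ⟨c, hc0, Q', ?_⟩
      rw [← Ideal.Quotient.eq_zero_iff_mem, map_sub, map_mul, ← hg, ← hs, mul_comm, sub_self]
    obtain ⟨e, he⟩ := MvPolynomial.ne_zero_iff.1 hc
    obtain ⟨p, hp, σ, hσ⟩ := exists_ringHom_algebraicClosure_zmod R (r * coeff e c)
      (mul_ne_zero hr he)
    rw [map_mul] at hσ
    obtain ⟨Γ, F', h, hΓ, hF', hfix', hh⟩ := hspec _ σ (left_ne_zero_of_mul hσ)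
    have hΓ0 : ∀ (x : Γ), ∀ Q ∈ I, eval₂ σ (subCoords Γ x) Q = 0 := fun x => (hΓ x).1 x.2
    have hΓpt : ∀ x : Coord n → AlgebraicClosure (ZMod p), (∀ Q ∈ I, eval₂ σ x Q = 0) →
        ∃ g : Γ, subCoords Γ g = x := by
      intro x hx
      obtain ⟨g, rfl⟩ := exists_coords_eq_of_vanishing G ι σ x hx
      exact ⟨⟨g, (hΓ g).2 hx⟩, rfl⟩
    have hcσ : map σ c ≠ 0 := MvPolynomial.ne_zero_iff.2 ⟨e, by
      rw [coeff_map]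
      exact right_ne_zero_of_mul hσ⟩
    have hcl : IsZClosed (Γ : Set (GL (Fin n) (AlgebraicClosure (ZMod p)))) := by
      refine ⟨map σ '' I, ?_⟩
      ext x
      rw [SetLike.mem_coe, hΓ]
      simp [eval_map]
    have hcQ : ∀ x : Γ, eval (fun j => eval (subCoords Γ x) (map σ (T j))) (map σ c) ≠ 0 →
        eval₂ σ (subCoords Γ x) Q ≠ 0 := by
      intro x hx hQx
      apply hx
      have := hΓ0 x _ hQ'
      rw [eval₂_sub, eval₂_mul, hQx, zero_mul, sub_zero, eval₂_bind₁'] at this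
      simpa [eval_map] using this
    obtain ⟨⟨γ, hγ⟩, hden⟩ := lang_image_dense p Γ hcl F' (fun i => map σ (P i))
      (fun g => by simp only [eval_map]; exact hF' g) hfix' (fun j => map σ (T j)) (by
        intro v
        obtain ⟨ψ, hψ⟩ := exists_extension_of_isIntegral g hgft hgint hginj (eval₂Hom σ v)
        have hψR : ψ.comp (algebraMap R S) = σ := by
          ext a
          have := RingHom.congr_fun hψ (C a)
          rw [RingHom.comp_apply, hg, bind₁_C_right, eval₂Hom_C] at this
          exact this
        obtain ⟨x, hx⟩ := hΓpt _ (hpts0 σ ψ hψR)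
        refine ⟨x, ?_⟩
        ext j
        rw [hx, eval_map, ← hpts σ ψ hψR]
        have := RingHom.congr_fun hψ (X j)
        rwa [RingHom.comp_apply, hg, bind₁_X_right, coe_eval₂Hom, eval₂_X] at this)
      (fun i => (M i).map (map σ)) (fun i => (hM i).map _) (by
        intro i x
        have := hΓ0 x _ (hint i)
        rw [← coe_eval₂Hom, Polynomial.hom_eval₂] at this
        rw [Polynomial.eval₂_map, Polynomial.hom_eval₂]
        have h1 : ((eval (subCoords Γ x)).comp (bind₁ fun j => map σ (T j) :
            MvPolynomial (Fin d) _ →ₐ[AlgebraicClosure (ZMod p)] _).toRingHom).comp (map σ) =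
            (eval₂Hom σ (subCoords Γ x)).comp
              (bind₁ T : MvPolynomial (Fin d) R →ₐ[R] _).toRingHom := by
          apply MvPolynomial.ringHom_ext
          · intro a
            simp
          · intro j
            simp [eval_map]
        rw [← RingHom.comp_assoc] at *
        simp only [h1]
        simpa using this) (map σ c) hcσ
    refine ⟨fun hmem => ?_, ?_⟩
    · have := hΓ0 γ _ hmem
      rw [eval₂_bind₁', eval₂_langPoly σ Γ F' P hF'] at this
      exact hcQ _ hγ this
    · obtain ⟨y, hy, hyc⟩ := hden h hh
      refine ⟨_, inferInstance, inferInstance, σ, subCoords Γ y, hΓ0 y, hcQ y hyc, ?_⟩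
      intro x hx hxy
      obtain ⟨x, rfl⟩ := hΓpt x hx
      rw [eval₂_langPoly σ Γ F' P hF'] at hxy
      exact hy x (Subtype.ext (coords_injective hxy))
  have hLI : ∀ Q ∈ I, bind₁ (langPoly P) Q ∈ I := by
    intro Q hQ
    refine mem_vanishingIdealOver.2 fun x => ?_
    rw [eval₂_bind₁', eval₂_langPoly ι G F P hP]
    exact mem_vanishingIdealOver.1 hQ _
  let φ : S →+* S := Ideal.Quotient.lift I
    ((Ideal.Quotient.mk I).comp (bind₁ (langPoly P) : _ →ₐ[R] _).toRingHom)
    (fun Q hQ => Ideal.Quotient.eq_zero_iff_mem.2 (hLI Q hQ))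
  have hφ : ∀ Q, φ (Ideal.Quotient.mk I Q) = Ideal.Quotient.mk I (bind₁ (langPoly P) Q) :=
    fun Q => rfl
  have hφinj : Function.Injective φ := by
    refine (injective_iff_map_eq_zero φ).2 fun s hs => ?_
    obtain ⟨Q, rfl⟩ := Ideal.Quotient.mk_surjective s
    rw [hφ, Ideal.Quotient.eq_zero_iff_mem] at hs
    exact Ideal.Quotient.eq_zero_iff_mem.2 (by_contra fun hQ => (key Q hQ).1 hs)
  have hφR : φ.comp (algebraMap R S) = algebraMap R S := by
    ext a
    change Ideal.Quotient.mk I (bind₁ (langPoly P) (C a)) = _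
    rw [bind₁_C_right]
    rfl
  have hSnoeth : IsNoetherianRing S := inferInstance
  have hSdom : IsDomain S := inferInstance
  obtain ⟨a, ha, hext⟩ := exists_ne_zero_forall_extension φ (hft φ hφR) hφinj
  obtain ⟨Q, rfl⟩ := Ideal.Quotient.mk_surjective a
  obtain ⟨-, Ω, _, _, σ, y, hy, hyQ, hyL⟩ :=
    key Q fun hQ => ha (Ideal.Quotient.eq_zero_iff_mem.2 hQ)
  let ψ : S →+* Ω := Ideal.Quotient.lift I (eval₂Hom σ y) hy
  obtain ⟨ψ', hψ'⟩ := hext Ω ψ hyQ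
  have hψ'R : ψ'.comp (algebraMap R S) = σ := by
    rw [← hφR, ← RingHom.comp_assoc, hψ']
    ext a
    exact eval₂_C _ _ _
  refine hyL _ (hpts0 σ ψ' hψ'R) ?_
  ext i
  rw [← hpts σ ψ' hψ'R]
  have := RingHom.congr_fun hψ' (Ideal.Quotient.mk I (X i))
  rw [RingHom.comp_apply, hφ, bind₁_X_right] at this
  rw [this]
  exact eval₂_X _ _ _

end LangMap

section Main

variable {k : Type} [Field k] {n : ℕ}

theorem isIrreducible_univ_of_isZConnected (G : Subgroup (GL (Fin n) k))
    (hconn : IsZConnected (G : Set (GL (Fin n) k))) :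
    @IsIrreducible G (zariskiTopology (subCoords G)) Set.univ := by
  let _ := zariskiTopology (subCoords G)
  have := noetherianSpace_zariskiTopology (subCoords G)
  have hl := continuous_mul_left_zariski G
  have hr := continuous_mul_right_zariski G
  have hi := continuous_inv_zariski G
  have h1 := isClosed_identityComponent hl hr hi
  have h2 := isClosed_compl_identityComponent hl hr hi
  obtain ⟨I, hI⟩ := (isClosed_zariskiTopology_iff (subCoords G) _).1 h1
  obtain ⟨J, hJ⟩ := (isClosed_zariskiTopology_iff (subCoords G) _).1 h2
  obtain ⟨S, hS, hSI⟩ : ∃ S : Set (GL (Fin n) k), IsZClosed S ∧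
      ∀ x : G, (x : GL (Fin n) k) ∈ S ↔ x ∈ identityComponent hl hr hi :=
    ⟨_, ⟨I, rfl⟩, fun x => (Set.ext_iff.1 hI x).symm⟩
  obtain ⟨T, hT, hTJ⟩ : ∃ T : Set (GL (Fin n) k), IsZClosed T ∧
      ∀ x : G, (x : GL (Fin n) k) ∈ T ↔ x ∉ identityComponent hl hr hi :=
    ⟨_, ⟨J, rfl⟩, fun x => (Set.ext_iff.1 hJ x).symm⟩
  have hcover : (G : Set (GL (Fin n) k)) ⊆ S ∪ T := fun x hx =>
    (em (⟨x, hx⟩ ∈ identityComponent hl hr hi)).imp (hSI ⟨x, hx⟩).2 (hTJ ⟨x, hx⟩).2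
  have hdisj : (G : Set (GL (Fin n) k)) ∩ (S ∩ T) = ∅ := by
    rw [Set.eq_empty_iff_forall_notMem]
    rintro x ⟨hx, h3, h4⟩
    exact (hTJ ⟨x, hx⟩).1 h4 ((hSI ⟨x, hx⟩).1 h3)
  have huniv : (identityComponent hl hr hi : Set G) = Set.univ := by
    rcases hconn S T hS hT hcover hdisj with h | h
    · exact absurd ⟨G.one_mem, (hSI 1).2 (Subgroup.one_mem _)⟩
        (Set.eq_empty_iff_forall_notMem.1 h 1)
    · rw [Set.eq_univ_iff_forall]
      intro x
      by_contra hx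
      exact Set.eq_empty_iff_forall_notMem.1 h x ⟨x.2, (hTJ x).2 hx⟩
  rw [← huniv]
  exact isIrreducible_identityComponent hl hr hi

theorem exists_map_eq_of_coeff_mem {R τ : Type*} [CommRing R] (ι : R →+* k) (Q : MvPolynomial τ k)
    (h : ∀ d ∈ Q.support, coeff d Q ∈ ι.range) : ∃ Q', map ι Q' = Q := by
  change Q ∈ Set.range (map ι)
  rw [mem_range_map_iff_coeffs_subset]
  intro a ha
  obtain ⟨d, hd, rfl⟩ := mem_coeffs_iff.1 ha
  exact h d hd

theorem lang_map_surjective [IsAlgClosed k] (G : Subgroup (GL (Fin n) k))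
    (hcl : IsZClosed (G : Set (GL (Fin n) k))) (hconn : IsZConnected (G : Set (GL (Fin n) k)))
    (F : G →* G) (P : Coord n → MvPolynomial (Coord n) k)
    (hP : ∀ g, subCoords G (F g) = fun i => eval (subCoords G g) (P i))
    (hfix : {g | F g = g}.Finite) (h₀ : G) : ∃ g, g⁻¹ * F g = h₀ := by
  classical
  by_contra! hh₀
  set I := idealOf (subCoords G) Set.univ with hI
  have hprime : I.IsPrime := isPrime_idealOf _ (isIrreducible_univ_of_isZConnected G hconn)
  have hGI : ∀ x : Coord n → k, (∀ Q ∈ I, eval x Q = 0) → ∃ g : G, subCoords G g = x := by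
    intro x hx
    obtain ⟨g, hg, rfl⟩ := exists_mem_coords_eq G hcl x fun Q hQ => hx Q fun g _ => hQ g g.2
    exact ⟨⟨g, hg⟩, rfl⟩
  obtain ⟨gens, hgens⟩ := (inferInstance : IsNoetherianRing (MvPolynomial (Coord n) k)).noetherian I
  obtain ⟨d, g, hginj, hgint⟩ := exists_integral_inj_algHom_of_fg k (MvPolynomial (Coord n) k ⧸ I)
  choose T hT using fun j => Ideal.Quotient.mk_surjective (g (X j))
  have hg : ∀ c, g c = Ideal.Quotient.mk I (bind₁ T c) := by
    intro c
    have : g = (Ideal.Quotient.mkₐ k I).comp (bind₁ T) := by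
      ext j
      simp [hT]
    rw [this]
    rfl
  choose M hM hMint using fun i => hgint (Ideal.Quotient.mk I (X i))
  have hMI : ∀ i, (M i).eval₂ (bind₁ T : MvPolynomial (Fin d) k →ₐ[k] _).toRingHom (X i) ∈ I := by
    intro i
    rw [← Ideal.Quotient.eq_zero_iff_mem, Polynomial.hom_eval₂]
    have : (Ideal.Quotient.mk I).comp (bind₁ T : MvPolynomial (Fin d) k →ₐ[k] _).toRingHom =
        g.toRingHom := RingHom.ext fun c => (hg c).symm
    rw [this]
    exact hMint i
  -- the ring of definition
  let cf : ∀ {τ : Type}, MvPolynomial τ k → Finset k := fun Q => Q.support.image fun d => coeff d Q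
  let s : Finset k := gens.biUnion cf ∪ Finset.univ.biUnion (fun i => cf (P i)) ∪
    Finset.univ.biUnion (fun j => cf (T j)) ∪
    Finset.univ.biUnion (fun i => (M i).support.biUnion fun e => cf ((M i).coeff e)) ∪
    (insert h₀ hfix.toFinset).biUnion (fun g => Finset.univ.image (subCoords G g))
  let R := Algebra.adjoin ℤ (s : Set k)
  let ι : R →+* k := R.val.toRingHom
  have hι : Function.Injective ι := Subtype.val_injective
  have hRft : Algebra.FiniteType ℤ R := R.fg_iff_finiteType.1 ⟨s, rfl⟩
  have hs : ∀ x ∈ s, x ∈ ι.range := fun x hx => ⟨⟨x, Algebra.subset_adjoin hx⟩, rfl⟩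
  have hcf : ∀ {τ : Type} (Q : MvPolynomial τ k), cf Q ⊆ s → ∃ Q', map ι Q' = Q := by
    intro τ Q hQ
    exact exists_map_eq_of_coeff_mem ι Q fun d hd => hs _ (hQ (Finset.mem_image_of_mem _ hd))
  obtain ⟨P', hP'⟩ : ∃ P' : Coord n → MvPolynomial (Coord n) R, ∀ i, map ι (P' i) = P i := by
    choose P' hP' using fun i => hcf (P i) fun x hx => by
      simp only [s, Finset.mem_union, Finset.mem_biUnion]
      exact Or.inl (Or.inl (Or.inl (Or.inr ⟨i, Finset.mem_univ _, hx⟩)))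
    exact ⟨P', hP'⟩
  obtain ⟨T', hT'⟩ : ∃ T' : Fin d → MvPolynomial (Coord n) R, ∀ j, map ι (T' j) = T j := by
    choose T' hT' using fun j => hcf (T j) fun x hx => by
      simp only [s, Finset.mem_union, Finset.mem_biUnion]
      exact Or.inl (Or.inl (Or.inr ⟨j, Finset.mem_univ _, hx⟩))
    exact ⟨T', hT'⟩
  obtain ⟨M', hM', hM'monic⟩ : ∃ M' : Coord n → Polynomial (MvPolynomial (Fin d) R),
      (∀ i, (M' i).map (map ι) = M i) ∧ ∀ i, (M' i).Monic := by
    have : ∀ i, M i ∈ Polynomial.lifts (map ι : MvPolynomial (Fin d) R →+* _) := by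
      intro i
      rw [Polynomial.lifts_iff_coeff_lifts]
      intro e
      by_cases he : e ∈ (M i).support
      · exact hcf _ fun x hx => by
          simp only [s, Finset.mem_union, Finset.mem_biUnion]
          exact Or.inl (Or.inr ⟨i, Finset.mem_univ _, e, he, hx⟩)
      · exact ⟨0, by rw [map_zero, Polynomial.notMem_support_iff.1 he]⟩
    choose M' hM' _ hM'monic using fun i =>
      Polynomial.lifts_and_natDegree_eq_and_monic (this i) (hM i)
    exact ⟨M', hM', hM'monic⟩
  have hcoord : ∀ g ∈ insert h₀ hfix.toFinset, ∀ i, ∃ a : R, ι a = subCoords G g i := by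
    intro g hg i
    exact hs _ (by
      simp only [s, Finset.mem_union, Finset.mem_biUnion]
      exact Or.inr ⟨g, hg, Finset.mem_image_of_mem _ (Finset.mem_univ i)⟩)
  choose! α hα using hcoord
  have hmem : ∀ Q : MvPolynomial (Coord n) R, Q ∈ vanishingIdealOver ι (subCoords G) ↔
      map ι Q ∈ I := by
    intro Q
    rw [mem_vanishingIdealOver]
    simp only [hI, mem_idealOf, eval_map, Set.mem_univ, true_imp_iff]
  have hprime' : (vanishingIdealOver ι (subCoords G)).IsPrime := by
    have : vanishingIdealOver ι (subCoords G) = I.comap (map ι) := Ideal.ext hmem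
    rw [this]
    exact hprime.comap _
  have hbind : ∀ c, map ι (bind₁ T' c) = bind₁ T (map ι c) := by
    intro c
    rw [map_bind₁]
    simp only [hT']
  refine false_of_arithmetic_counterexample ι hι G ?_ hprime' F P' ?_
    (fun i => ∏ a ∈ hfix.toFinset, (Polynomial.X - Polynomial.C (α a i)))
    (fun i => Polynomial.monic_prod_of_monic _ _ fun a _ => Polynomial.monic_X_sub_C _) ?_ h₀ (α h₀)
    ?_ hh₀ T' ?_ M' hM'monic ?_
  · intro x hx
    refine hGI x ?_
    have hle : I ≤ RingHom.ker (eval x) := by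
      rw [← hgens]
      refine Submodule.span_le.2 fun Q hQ => ?_
      obtain ⟨Q', rfl⟩ := hcf Q fun y hy => by
        simp only [s, Finset.mem_union, Finset.mem_biUnion]
        exact Or.inl (Or.inl (Or.inl (Or.inl ⟨Q, hQ, hy⟩)))
      change eval x _ = 0
      rw [eval_map]
      refine hx Q' ((hmem Q').2 ?_)
      rw [← hgens]
      exact Submodule.subset_span hQ
    exact fun Q hQ => hle hQ
  · intro g
    simp only [← eval_map, hP']
    exact hP g
  · intro a ha i
    have ha' : a ∈ hfix.toFinset := by simpa using ha
    rw [Polynomial.eval₂_finsetProd]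
    refine Finset.prod_eq_zero ha' ?_
    rw [Polynomial.eval₂_sub, Polynomial.eval₂_X, Polynomial.eval₂_C,
      hα a (Finset.mem_insert_of_mem ha'), sub_self]
  · ext i
    exact (hα h₀ (Finset.mem_insert_self _ _) i).symm
  · intro c hc
    rw [hmem, hbind, ← Ideal.Quotient.eq_zero_iff_mem, ← hg, map_eq_zero_iff g hginj] at hc
    exact (map_eq_zero_iff _ (map_injective ι hι)).1 hc
  · intro i
    rw [hmem, Polynomial.hom_eval₂, map_X]
    have h1 : (map ι).comp (bind₁ T' : MvPolynomial (Fin d) R →ₐ[R] _).toRingHom =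
        (bind₁ T : MvPolynomial (Fin d) k →ₐ[k] _).toRingHom.comp (map ι) :=
      RingHom.ext fun c => hbind c
    rw [h1, ← Polynomial.eval₂_map, hM']
    exact hMI i

end Main

/-- **Lang–Steinberg theorem.** Let `G` be a connected affine algebraic group over an
algebraically closed field `k` and `F : G → G` an isogeny whose fixed-point group
`G^F` is finite.  Then the Lang map `g ↦ g⁻¹ · F g` is surjective. -/
theorem lang_map_surjective_of_finite_fixed_points
    {k : Type} [Field k] [IsAlgClosed k] {n : ℕ}
    (G : Subgroup (GL (Fin n) k))
    (hGcl : IsZClosed (G : Set (GL (Fin n) k)))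
    (hGconn : IsZConnected (G : Set (GL (Fin n) k)))
    (F : GL (Fin n) k → GL (Fin n) k) (hF : IsIsogeny G G F)
    (hfix : {g : GL (Fin n) k | g ∈ G ∧ F g = g}.Finite) :
    ∀ h ∈ G, ∃ g ∈ G, g⁻¹ * F g = h := by
  intro h hh
  obtain ⟨P, hP⟩ := hF.regular
  let F' : G →* G := MonoidHom.mk' (fun g => ⟨F g, hF.maps g g.2⟩)
    fun x y => Subtype.ext (hF.hom x x.2 y y.2)
  obtain ⟨g, hg⟩ := lang_map_surjective G hGcl hGconn F' P (fun g => hP g g.2)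
    ((hfix.preimage Subtype.val_injective.injOn).subset
      fun g hg => ⟨g.2, (congrArg (Subtype.val : G → _) hg :)⟩) ⟨h, hh⟩
  exact ⟨g, g.2, (congrArg (Subtype.val : G → _) hg :)⟩

end
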